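/- arXiv:1909.01978 — 8 statements merged into one kernel-verified Lean document; each statement's English description precedes it below -/
import Mathlib

section
/- Let G be an undirected simple graph on [d] = {1,…,d} with g edges. Identify the set of positive definite symmetric matrices A ∈ ℝ^{d×d} whose support is G° (i.e., for all i ≠ j, A_{i,j} ≠ 0 if and only if ij is an edge of G) with a subset of ℝ^{g+d} via the d diagonal entries and the g edge entries. Then the subset of such matrices A for which Σ = A^{-1} is not perfect w.r.t. G has (g+d)-dimensional Lebesgue measure zero. -/
open MeasureTheory

/-- `S` separates `A` from `B` in the simple graph `G`: every path from a vertex of `A` to a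
vertex of `B` passes through a vertex of `S`. -/
def Separates {d : ℕ} (G : SimpleGraph (Fin d)) (A B S : Set (Fin d)) : Prop :=
  ∀ a ∈ A, ∀ b ∈ B, ∀ p : G.Walk a b, p.IsPath → ∃ c ∈ S, c ∈ p.support

/-- Determinant of the submatrix of `M` with rows indexed by `{i} ∪ S` and columns
indexed by `{j} ∪ S`. -/
noncomputable def subDet {d : ℕ} (M : Matrix (Fin d) (Fin d) ℝ) (i j : Fin d)
    (S : Finset (Fin d)) : ℝ :=
  (M.submatrix (fun k : Option {x // x ∈ S} => k.elim i Subtype.val)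
    (fun k : Option {x // x ∈ S} => k.elim j Subtype.val)).det

/-- A positive definite matrix `M` is perfect w.r.t. `G` if for all distinct `i, j` and all
`S ⊆ [d] \ {i,j}`, `det M_{iS,jS} = 0` iff `S` separates `{i}` from `{j}` in `G`. -/
def IsPerfect {d : ℕ} (G : SimpleGraph (Fin d)) (M : Matrix (Fin d) (Fin d) ℝ) : Prop :=
  ∀ i j : Fin d, i ≠ j → ∀ S : Finset (Fin d), i ∉ S → j ∉ S →
    (subDet M i j S = 0 ↔ Separates G {i} {j} ↑S)

open Classical in
/-- The symmetric matrix with diagonal entries `x` and entry `y (edge index of ij)` in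
position `(i,j)` for each edge `ij` of `G` (and `0` elsewhere), where `η` enumerates the
edges of `G`. -/
noncomputable def matOf {d g : ℕ} (G : SimpleGraph (Fin d)) (η : Fin g ≃ G.edgeSet)
    (x : Fin d → ℝ) (y : Fin g → ℝ) : Matrix (Fin d) (Fin d) ℝ :=
  fun i j => if i = j then x i else
    if h : G.Adj i j then y (η.symm ⟨s(i,j), h⟩) else 0

/-- A continuous function on a finite-dimensional space which is polynomial along all lines through
a point where it does not vanish has a null zero set. -/
theorem addHaar_zeroSet_eq_zero_of_polynomial_on_lines {E : Type*} [NormedAddCommGroup E]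
    [NormedSpace ℝ E] [FiniteDimensional ℝ E] [MeasurableSpace E] [BorelSpace E]
    (μ : Measure E) [μ.IsAddHaarMeasure] {f : E → ℝ} (hf : Continuous f) {a : E} (ha : f a ≠ 0)
    (hp : ∀ v, ∃ P : Polynomial ℝ, ∀ t : ℝ, f (a + t • v) = P.eval t) :
    μ {x | f x = 0} = 0 := by
  have hcont : Continuous fun q : ℝ × E => f (a + q.1 • q.2) := by fun_prop
  have hF : MeasurableSet {q : ℝ × E | f (a + q.1 • q.2) = 0} :=
    (isClosed_singleton.preimage hcont).measurableSet
  have hnull : (volume.prod μ) {q : ℝ × E | f (a + q.1 • q.2) = 0} = 0 := by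
    rw [Measure.prod_apply_symm hF]
    refine (lintegral_congr fun v => ?_).trans lintegral_zero
    obtain ⟨P, hP⟩ := hp v
    have hP0 : P ≠ 0 := by
      rintro rfl
      exact ha (by simpa using hP 0)
    have hsub : (fun t : ℝ => (t, v)) ⁻¹' {q : ℝ × E | f (a + q.1 • q.2) = 0} ⊆
        {t | P.IsRoot t} := fun t ht => (hP t).symm.trans ht
    exact ((Polynomial.finite_setOfPred_isRoot hP0).subset hsub).measure_zero _
  have hae := (Measure.measure_prod_null hF).1 hnull
  have hne : ∀ᵐ t : ℝ, t ≠ 0 := Measure.ae_ne volume 0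
  obtain ⟨t, ht, ht0⟩ := (hae.and hne).exists
  change μ (Prod.mk t ⁻¹' {q : ℝ × E | f (a + q.1 • q.2) = 0}) = 0 at ht
  have hset : Prod.mk t ⁻¹' {q : ℝ × E | f (a + q.1 • q.2) = 0} =
      (fun v => t • v) ⁻¹' ((fun x => a + x) ⁻¹' {x | f x = 0}) := rfl
  rw [hset, Measure.addHaar_preimage_smul μ ht0, measure_preimage_add] at ht
  simpa [ht0] using ht

/-- The matrix `1 + L`, where `L` is the Laplacian of the weights `w`. -/
def shiftedLaplacian {n : Type*} [Fintype n] [DecidableEq n] (w : n → n → ℝ) : Matrix n n ℝ :=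
  fun k l => if k = l then 1 + ∑ m, w k m else -w k l

theorem shiftedLaplacian_mulVec {n : Type*} [Fintype n] [DecidableEq n] {w : n → n → ℝ}
    (hw : ∀ k, w k k = 0) (u : n → ℝ) (k : n) :
    (shiftedLaplacian w).mulVec u k = u k + ∑ l, w k l * (u k - u l) := by
  have h : ∀ l, shiftedLaplacian w k l * u l =
      (if k = l then (1 + ∑ m, w k m) * u k else 0) - w k l * u l := by
    intro l
    by_cases hkl : k = l
    · subst hkl
      simp [shiftedLaplacian, hw]
    · simp [shiftedLaplacian, hkl]
  simp only [Matrix.mulVec, dotProduct, h, mul_sub, Finset.sum_sub_distrib, Finset.sum_ite_eq,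
    Finset.mem_univ, if_true, ← Finset.sum_mul]
  ring

/-- The minimum principle for `shiftedLaplacian`. -/
theorem nonneg_of_shiftedLaplacian_mulVec_nonneg {n : Type*} [Fintype n] [DecidableEq n]
    {w : n → n → ℝ} (hw : ∀ k, w k k = 0) (hw0 : ∀ k l, 0 ≤ w k l) {u : n → ℝ}
    (hu : ∀ k, 0 ≤ (shiftedLaplacian w).mulVec u k) (k : n) : 0 ≤ u k := by
  have : Nonempty n := ⟨k⟩
  obtain ⟨m, hm⟩ := Finite.exists_min u
  refine le_trans ?_ (hm k)
  have h := hu m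
  rw [shiftedLaplacian_mulVec hw] at h
  have : ∑ l, w m l * (u m - u l) ≤ 0 := Finset.sum_nonpos fun l _ =>
    mul_nonpos_of_nonneg_of_nonpos (hw0 m l) (by linarith [hm l])
  linarith

theorem det_shiftedLaplacian_ne_zero {n : Type*} [Fintype n] [DecidableEq n]
    {w : n → n → ℝ} (hw : ∀ k, w k k = 0) (hw0 : ∀ k l, 0 ≤ w k l) :
    (shiftedLaplacian w).det ≠ 0 := by
  intro h
  obtain ⟨v, hv, h0⟩ := Matrix.exists_mulVec_eq_zero_iff.2 h
  refine hv (funext fun k => le_antisymm ?_ ?_)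
  · have := nonneg_of_shiftedLaplacian_mulVec_nonneg hw hw0 (u := -v)
      (fun k => by simp [Matrix.mulVec_neg, h0]) k
    simpa using this
  · exact nonneg_of_shiftedLaplacian_mulVec_nonneg hw hw0 (fun k => by simp [h0]) k

theorem eq_zero_of_shiftedLaplacian_mulVec_nonneg {n : Type*} [Fintype n] [DecidableEq n]
    {w : n → n → ℝ} (hw : ∀ k, w k k = 0) (hw0 : ∀ k l, 0 ≤ w k l) {u : n → ℝ}
    (hu : ∀ k, 0 ≤ (shiftedLaplacian w).mulVec u k) {k : n} (hk : u k = 0) :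
    (shiftedLaplacian w).mulVec u k = 0 ∧ ∀ l, w k l ≠ 0 → u l = 0 := by
  have hnn := nonneg_of_shiftedLaplacian_mulVec_nonneg hw hw0 hu
  have h := hu k
  have hterm : ∀ l ∈ Finset.univ, 0 ≤ w k l * u l := fun l _ => mul_nonneg (hw0 k l) (hnn l)
  have heq : (shiftedLaplacian w).mulVec u k = -∑ l, w k l * u l := by
    simp [shiftedLaplacian_mulVec hw, hk]
  have hsum : ∑ l, w k l * u l = 0 :=
    le_antisymm (by linarith) (Finset.sum_nonneg hterm)
  refine ⟨by rw [heq, hsum, neg_zero], fun l hl => ?_⟩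
  have := (Finset.sum_eq_zero_iff_of_nonneg hterm).1 hsum l (Finset.mem_univ l)
  exact (mul_eq_zero.1 this).resolve_left hl

theorem subDet_smul {d : ℕ} (c : ℝ) (M : Matrix (Fin d) (Fin d) ℝ) (i j : Fin d)
    (S : Finset (Fin d)) :
    subDet (c • M) i j S = c ^ (Fintype.card (Option {x // x ∈ S})) * subDet M i j S := by
  simp only [subDet, Matrix.submatrix_smul, Pi.smul_apply, Matrix.det_smul]

theorem subDet_inv_eq_zero_iff {d : ℕ} {M : Matrix (Fin d) (Fin d) ℝ} (hM : M.det ≠ 0)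
    (i j : Fin d) (S : Finset (Fin d)) :
    subDet M⁻¹ i j S = 0 ↔ subDet M.adjugate i j S = 0 := by
  rw [Matrix.inv_def, subDet_smul, Ring.inverse_eq_inv']
  simp [hM]

theorem exists_polynomial_subDet_adjugate {d : ℕ} (M N : Matrix (Fin d) (Fin d) ℝ) (i j : Fin d)
    (S : Finset (Fin d)) :
    ∃ P : Polynomial ℝ, ∀ t : ℝ, subDet (M + t • N).adjugate i j S = P.eval t := by
  let Q : Matrix (Fin d) (Fin d) (Polynomial ℝ) :=
    M.map Polynomial.C + (Polynomial.X : Polynomial ℝ) • N.map Polynomial.C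
  refine ⟨(Q.adjugate.submatrix (fun k : Option {x // x ∈ S} => k.elim i Subtype.val)
    (fun k : Option {x // x ∈ S} => k.elim j Subtype.val)).det, fun t => ?_⟩
  have hQ : (Polynomial.evalRingHom t).mapMatrix Q = M + t • N := by
    ext k l
    simp [Q, mul_comm t]
  rw [← Polynomial.coe_evalRingHom, RingHom.map_det, subDet, ← hQ, ← RingHom.map_adjugate]
  rfl

theorem matOf_add_smul {d g : ℕ} (G : SimpleGraph (Fin d)) (η : Fin g ≃ G.edgeSet)
    (a v : (Fin d → ℝ) × (Fin g → ℝ)) (t : ℝ) :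
    matOf G η (a + t • v).1 (a + t • v).2 = matOf G η a.1 a.2 + t • matOf G η v.1 v.2 := by
  ext k l
  simp only [matOf, Matrix.add_apply, Matrix.smul_apply]
  split_ifs <;> simp

theorem continuous_matOf {d g : ℕ} (G : SimpleGraph (Fin d)) (η : Fin g ≃ G.edgeSet) :
    Continuous fun p : (Fin d → ℝ) × (Fin g → ℝ) => matOf G η p.1 p.2 := by
  refine continuous_matrix fun k l => ?_
  unfold matOf
  split_ifs <;> fun_prop

theorem continuous_subDet_adjugate_matOf {d g : ℕ} (G : SimpleGraph (Fin d))
    (η : Fin g ≃ G.edgeSet) (i j : Fin d) (S : Finset (Fin d)) :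
    Continuous fun p : (Fin d → ℝ) × (Fin g → ℝ) =>
      subDet (matOf G η p.1 p.2).adjugate i j S :=
  (((continuous_matOf G η).matrix_adjugate).matrix_submatrix _ _).matrix_det

/-- If `S` separates `i` from `j`, the corresponding minor of the inverse vanishes. -/
theorem subDet_inv_matOf_eq_zero_of_separates {d g : ℕ} (G : SimpleGraph (Fin d))
    (η : Fin g ≃ G.edgeSet) {x : Fin d → ℝ} {y : Fin g → ℝ} (hA : (matOf G η x y).PosDef)
    {i j : Fin d} {S : Finset (Fin d)} (hi : i ∉ S) (hj : j ∉ S)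
    (hsep : Separates G {i} {j} ↑S) : subDet (matOf G η x y)⁻¹ i j S = 0 := by
  classical
  set A := matOf G η x y with hAdef
  let C : Fin d → Prop := fun k => ∃ p : G.Walk i k, ∀ c ∈ p.support, c ∉ S
  let D : Fin d → Prop := fun k => ¬ C k ∧ k ∉ S
  have hiC : C i := ⟨.nil, by simpa using hi⟩
  have hjD : D j := by
    refine ⟨?_, hj⟩
    rintro ⟨p, hp⟩
    obtain ⟨c, hcS, hc⟩ := hsep i rfl j rfl p.bypass p.bypass_isPath
    exact hp c (p.support_bypass_subset_support hc) hcS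
  have hACD : ∀ k l, C k → D l → A k l = 0 := by
    rintro k l ⟨p, hp⟩ ⟨hlC, hlS⟩
    have hne : k ≠ l := by
      rintro rfl
      exact hlC ⟨p, hp⟩
    have hadj : ¬ G.Adj k l := fun h => hlC ⟨p.concat h, fun c hc => by
      rw [SimpleGraph.Walk.support_concat] at hc
      simp only [List.mem_append, List.mem_singleton] at hc
      rcases hc with hc | rfl
      · exact hp c hc
      · exact hlS⟩
    simp [hAdef, matOf, hne, hadj]
  let B := A.submatrix (Subtype.val : {k // D k} → Fin d) (Subtype.val : {k // D k} → Fin d)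
  have hB : B.PosDef := hA.submatrix Subtype.val_injective
  let zD : {k // D k} → ℝ := B⁻¹.mulVec (Pi.single ⟨j, hjD⟩ 1)
  have hzD : B.mulVec zD = Pi.single ⟨j, hjD⟩ 1 := by
    rw [Matrix.mulVec_mulVec, Matrix.mul_nonsing_inv _ hB.det_pos.ne'.isUnit, Matrix.one_mulVec]
  let z : Fin d → ℝ := fun k => if h : D k then zD ⟨k, h⟩ else 0
  have hAz : ∀ k, A.mulVec z k = ∑ l : {l // D l}, A k l * zD l := by
    intro k
    rw [Matrix.mulVec, dotProduct, ← Fintype.sum_subtype_add_sum_subtype D]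
    have h2 : ∑ l : {l // ¬ D l}, A k l * z l = 0 :=
      Finset.sum_eq_zero fun l _ => by simp [z, l.2]
    rw [h2, add_zero]
    exact Finset.sum_congr rfl fun l _ => by simp [z, l.2]
  let w := A.mulVec z
  have hwD : ∀ k, D k → w k = if k = j then 1 else 0 := by
    intro k hk
    have := congrFun hzD ⟨k, hk⟩
    simp only [Pi.single_apply, Subtype.mk.injEq] at this
    exact (hAz k).trans this
  have hwC : ∀ k, C k → w k = 0 := fun k hk =>
    (hAz k).trans (Finset.sum_eq_zero fun l _ => by rw [hACD k l hk l.2, zero_mul])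
  have hw : ∀ k, k ≠ j → k ∉ S → w k = 0 := by
    intro k hkj hkS
    by_cases hC : C k
    · exact hwC k hC
    · rw [hwD k ⟨hC, hkS⟩, if_neg hkj]
  have hz : A⁻¹.mulVec w = z := by
    rw [Matrix.mulVec_mulVec, Matrix.nonsing_inv_mul _ hA.det_pos.ne'.isUnit, Matrix.one_mulVec]
  refine Matrix.exists_mulVec_eq_zero_iff.1
    ⟨fun k : Option {x // x ∈ S} => w (k.elim j Subtype.val), fun h => ?_, funext fun r => ?_⟩
  · have := congrFun h none
    simp [hwD j hjD] at this
  · have hr : z (r.elim i Subtype.val) = 0 := by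
      have : ¬ D (r.elim i Subtype.val) := by
        rcases r with _ | s
        · exact fun h => h.1 hiC
        · exact fun h => h.2 s.2
      simp [z, this]
    rw [Pi.zero_apply, ← hr, ← hz, Matrix.mulVec, Matrix.mulVec, dotProduct, dotProduct,
      Fintype.sum_option]
    have hS : ∑ l, A⁻¹ (r.elim i Subtype.val) l * w l =
        ∑ l ∈ insert j S, A⁻¹ (r.elim i Subtype.val) l * w l := by
      refine (Finset.sum_subset (Finset.subset_univ _) fun l _ hl => ?_).symm
      rw [Finset.mem_insert, not_or] at hl
      rw [hw l hl.1 hl.2, mul_zero]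
    rw [hS, Finset.sum_insert hj, ← Finset.sum_coe_sort S]
    rfl

/-- If `S` does not separate `i` from `j`, some matrix supported on `G°` has a nonvanishing minor. -/
theorem exists_subDet_adjugate_matOf_ne_zero {d g : ℕ} (G : SimpleGraph (Fin d))
    (η : Fin g ≃ G.edgeSet) {i j : Fin d} {S : Finset (Fin d)} (hi : i ∉ S) (hj : j ∉ S)
    (hsep : ¬ Separates G {i} {j} ↑S) :
    ∃ p : (Fin d → ℝ) × (Fin g → ℝ), subDet (matOf G η p.1 p.2).adjugate i j S ≠ 0 := by
  classical
  let w : Fin d → Fin d → ℝ := fun k l => if G.Adj k l ∧ k ∉ S ∧ l ∉ S then 1 else 0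
  have hw : ∀ k, w k k = 0 := fun k => by simp [w]
  have hw0 : ∀ k l, 0 ≤ w k l := fun k l => by
    simp only [w]
    split_ifs <;> norm_num
  refine ⟨(fun k => 1 + ∑ m, w k m, fun e => if ∀ c ∈ (η e).1, c ∉ S then -1 else 0), ?_⟩
  have hmat : matOf G η (fun k => 1 + ∑ m, w k m)
      (fun e => if ∀ c ∈ (η e).1, c ∉ S then -1 else 0) = shiftedLaplacian w := by
    ext k l
    by_cases hkl : k = l
    · simp [matOf, shiftedLaplacian, hkl]
    · by_cases hadj : G.Adj k l
      · simp only [matOf, shiftedLaplacian, hkl, hadj, w, if_false, dif_pos, true_and,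
          Equiv.apply_symm_apply, Sym2.mem_iff, forall_eq_or_imp, forall_eq]
        split_ifs <;> simp
      · simp [matOf, shiftedLaplacian, hkl, hadj, w]
  simp only [hmat]
  have hdet := det_shiftedLaplacian_ne_zero hw hw0
  rw [Ne, ← subDet_inv_eq_zero_iff hdet]
  set A := shiftedLaplacian w
  have hcol : ∀ l, A.mulVec (fun k => A⁻¹ k l) = Pi.single l 1 := by
    intro l
    have h := Matrix.mul_nonsing_inv A hdet.isUnit
    ext k
    have := congrFun (congrFun h k) l
    rw [Matrix.one_apply] at this
    rw [Pi.single_apply]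
    exact this
  have hnn : ∀ l k, 0 ≤ A.mulVec (fun k => A⁻¹ k l) k := by
    intro l k
    rw [hcol, Pi.single_apply]
    split_ifs <;> norm_num
  have hrow : ∀ s ∈ S, ∀ l, A⁻¹ s l = if s = l then 1 else 0 := by
    intro s hs l
    have h := congrFun (hcol l) s
    rw [shiftedLaplacian_mulVec hw, Pi.single_apply] at h
    simpa [w, hs] using h
  have hsymm : A⁻¹.IsSymm := by
    have : A.IsSymm := by
      ext k l
      simp only [Matrix.transpose_apply, A, shiftedLaplacian]
      by_cases hkl : k = l
      · simp [hkl]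
      · simp only [hkl, Ne.symm hkl, if_false, w, G.adj_comm l k, and_comm (a := l ∉ S)]
    rw [Matrix.IsSymm, Matrix.transpose_nonsing_inv, this]
  have hij : A⁻¹ i j ≠ 0 := by
    simp only [Separates, Set.mem_singleton_iff, forall_eq, not_forall, not_exists, not_and,
      Finset.mem_coe] at hsep
    obtain ⟨p, -, hp⟩ := hsep
    have key : ∀ {k l : Fin d} (q : G.Walk k l), (∀ c ∈ S, c ∉ q.support) → A⁻¹ k l ≠ 0 := by
      intro k l q
      induction q with
      | nil =>
        intro _ h0
        have := (eq_zero_of_shiftedLaplacian_mulVec_nonneg hw hw0 (hnn _) h0).1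
        rw [hcol] at this
        simp at this
      | cons hab q ih =>
        intro hq h0
        simp only [SimpleGraph.Walk.support_cons, List.mem_cons, not_or] at hq
        refine ih (fun c hc => (hq c hc).2)
          ((eq_zero_of_shiftedLaplacian_mulVec_nonneg hw hw0 (hnn _) h0).2 _ ?_)
        have ha := fun h => (hq _ h).1 rfl
        have hb := fun h => (hq _ h).2 q.start_mem_support
        exact (if_pos ⟨hab, ha, hb⟩).trans_ne one_ne_zero
    exact key p hp
  have hdiag : A⁻¹.submatrix (fun k : Option {x // x ∈ S} => k.elim i Subtype.val)
      (fun k : Option {x // x ∈ S} => k.elim j Subtype.val) =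
      Matrix.diagonal fun k => k.elim (A⁻¹ i j) fun _ => 1 := by
    ext r c
    rcases r with _ | r <;> rcases c with _ | c
    · simp
    · have : A⁻¹ i c = 0 := by
        rw [← hsymm.apply, hrow c c.2, if_neg]
        rintro rfl
        exact hi c.2
      simpa using this
    · have : A⁻¹ r j = 0 := by
        rw [hrow r r.2, if_neg]
        rintro rfl
        exact hj r.2
      simpa using this
    · rw [Matrix.diagonal_apply, Matrix.submatrix_apply]
      simp [hrow r r.2]
  rw [subDet, hdiag, Matrix.det_diagonal, Fintype.prod_option]
  simpa using hij

/-- for an undirected simple graph `G` on `[d]` with `g` edges (enumerated by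
`η`), the set of positive definite matrices with support `G°`, identified with a subset of
`ℝ^d × ℝ^g ≅ ℝ^{g+d}` via the diagonal and edge entries, whose inverse `Σ` is not perfect
w.r.t. `G`, has `(g+d)`-dimensional Lebesgue measure zero. -/
theorem statement0 {d g : ℕ} (G : SimpleGraph (Fin d)) (η : Fin g ≃ G.edgeSet) :
    volume {p : (Fin d → ℝ) × (Fin g → ℝ) |
      (matOf G η p.1 p.2).PosDef ∧ (∀ k, p.2 k ≠ 0) ∧
      ¬ IsPerfect G (matOf G η p.1 p.2)⁻¹} = 0 := by
  have hzero : ∀ (i j : Fin d) (S : Finset (Fin d)),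
      volume {p : (Fin d → ℝ) × (Fin g → ℝ) | i ∉ S ∧ j ∉ S ∧ ¬ Separates G {i} {j} ↑S ∧
        subDet (matOf G η p.1 p.2).adjugate i j S = 0} = 0 := by
    intro i j S
    have : (volume : Measure ((Fin d → ℝ) × (Fin g → ℝ))).IsAddHaarMeasure :=
      Measure.prod.instIsAddHaarMeasure _ _
    by_cases h : i ∉ S ∧ j ∉ S ∧ ¬ Separates G {i} {j} ↑S
    · obtain ⟨a, ha⟩ := exists_subDet_adjugate_matOf_ne_zero G η h.1 h.2.1 h.2.2
      refine measure_mono_null (fun p hp => hp.2.2.2)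
        (addHaar_zeroSet_eq_zero_of_polynomial_on_lines volume
          (continuous_subDet_adjugate_matOf G η i j S) ha fun v => ?_)
      simp only [matOf_add_smul]
      exact exists_polynomial_subDet_adjugate _ _ i j S
    · exact measure_mono_null (fun p hp => h ⟨hp.1, hp.2.1, hp.2.2.1⟩) measure_empty
  refine measure_mono_null ?_ (measure_iUnion_null fun i => measure_iUnion_null fun j =>
    measure_iUnion_null fun S => hzero i j S)
  rintro p ⟨hA, -, hp⟩
  simp only [Set.mem_iUnion]
  by_contra! hcon
  refine hp fun i j _ S hi hj => ⟨fun h0 => ?_,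
    subDet_inv_matOf_eq_zero_of_separates G η hA hi hj⟩
  by_contra hsep
  exact hcon i j S ⟨hi, hj, hsep, (subDet_inv_eq_zero_iff hA.det_pos.ne' i j S).1 h0⟩
end

section
/- Let G be an undirected simple graph on [d] with g edges, and let μ be a probability distribution on ℝ^{g+d}, absolutely continuous with respect to the (g+d)-dimensional Lebesgue measure, whose induced distribution on symmetric d×d matrices A (placing the first d coordinates on the diagonal, the remaining g coordinates on the edges of G, and zeros elsewhere) is concentrated on positive definite matrices with support exactly G°. Then μ-almost surely, Σ = A^{-1} is perfect w.r.t. G. -/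
open MeasureTheory

open Matrix

/-- The matrix obtained from `M` by replacing the rows and columns indexed by `S` with those of
the identity matrix. -/
noncomputable def maskOut {n : Type*} [DecidableEq n] (S : Finset n) (M : Matrix n n ℝ) :
    Matrix n n ℝ :=
  Matrix.of fun a b => if a ∈ S ∨ b ∈ S then (1 : Matrix n n ℝ) a b else M a b

section MaskOut

variable {n : Type*} [Fintype n] [DecidableEq n] {S : Finset n} {M : Matrix n n ℝ}

lemma maskOut_mulVec_of_mem (v : n → ℝ) {a : n} (ha : a ∈ S) :
    (maskOut S M *ᵥ v) a = v a := by
  simp [mulVec, dotProduct, maskOut, ha, one_apply]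

lemma maskOut_mulVec_of_notMem {v : n → ℝ} (hv : ∀ b ∈ S, v b = 0) {a : n} (ha : a ∉ S) :
    (maskOut S M *ᵥ v) a = (M *ᵥ v) a := by
  simp only [mulVec, dotProduct]
  refine Finset.sum_congr rfl fun b _ => ?_
  by_cases hb : b ∈ S
  · simp [hv b hb]
  · simp [maskOut, ha, hb]

lemma det_maskOut_ne_zero (hM : M.PosDef) : (maskOut S M).det ≠ 0 := by
  intro h
  obtain ⟨w, hw, hMw⟩ := exists_mulVec_eq_zero_iff.mpr h
  have hS : ∀ b ∈ S, w b = 0 := fun b hb => by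
    rw [← maskOut_mulVec_of_mem (M := M) w hb, hMw]; rfl
  have hpos := hM.dotProduct_mulVec_pos hw
  refine hpos.ne' (Finset.sum_eq_zero fun a _ => ?_)
  by_cases ha : a ∈ S
  · simp [hS a ha]
  · rw [← maskOut_mulVec_of_notMem hS ha, hMw]; simp

end MaskOut

lemma eq_of_mulVec_eq_of_det_ne_zero {n : Type*} [Fintype n] [DecidableEq n]
    {M : Matrix n n ℝ} (hM : M.det ≠ 0) {v w : n → ℝ} (h : M *ᵥ v = M *ᵥ w) : v = w :=
  mulVec_injective_iff_isUnit.mpr ((isUnit_iff_isUnit_det M).mpr hM.isUnit) h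

/-- Extension by zero of a vector indexed by `{j} ∪ S`. -/
noncomputable def extendOption {d : ℕ} (j : Fin d) (S : Finset (Fin d))
    (z : Option {x // x ∈ S} → ℝ) : Fin d → ℝ :=
  fun b => if b = j then z none else if h : b ∈ S then z (some ⟨b, h⟩) else 0

lemma sum_option_elim_mul {d : ℕ} {j : Fin d} {S : Finset (Fin d)} (hj : j ∉ S)
    (F : Fin d → ℝ) (z : Option {x // x ∈ S} → ℝ) :
    ∑ k : Option {x // x ∈ S}, F (k.elim j Subtype.val) * z k =
      ∑ b, F b * extendOption j S z b := by
  have h1 : ∑ b ∈ S, F b * extendOption j S z b = ∑ s : {x // x ∈ S}, F s * z (some s) := by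
    rw [← Finset.sum_coe_sort S]
    refine Finset.sum_congr rfl fun s _ => ?_
    have : (s : Fin d) ≠ j := fun h => hj (h ▸ s.2)
    simp [extendOption, this]
  rw [Fintype.sum_option, ← Finset.sum_subset (Finset.subset_univ (insert j S)),
    Finset.sum_insert hj, h1]
  · simp [extendOption]
  · intro b _ hb
    rw [Finset.mem_insert, not_or] at hb
    simp [extendOption, hb.1, hb.2]

lemma subDet_inv_eq_zero_iff_s1 {d : ℕ} {A : Matrix (Fin d) (Fin d) ℝ} (hA : A.det ≠ 0)
    {i j : Fin d} {S : Finset (Fin d)} (hj : j ∉ S)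
    (hB : (maskOut S A).det ≠ 0) {v : Fin d → ℝ} (hv : maskOut S A *ᵥ v = Pi.single j 1) :
    subDet A⁻¹ i j S = 0 ↔ v i = 0 := by
  have hvS : ∀ b ∈ S, v b = 0 := fun b hb => by
    have hbj : b ≠ j := fun h => hj (h ▸ hb)
    rw [← maskOut_mulVec_of_mem (M := A) v hb, hv]; simp [hbj]
  have hN : ∀ (z : Option {x // x ∈ S} → ℝ) (k : Option {x // x ∈ S}),
      ((A⁻¹.submatrix (fun k : Option {x // x ∈ S} => k.elim i Subtype.val)
        (fun k : Option {x // x ∈ S} => k.elim j Subtype.val)) *ᵥ z) k =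
      (A⁻¹ *ᵥ extendOption j S z) (k.elim i Subtype.val) := fun z k =>
    sum_option_elim_mul hj (fun b => A⁻¹ (k.elim i Subtype.val) b) z
  unfold subDet
  rw [← exists_mulVec_eq_zero_iff]
  constructor
  · rintro ⟨z, hz, hNz⟩
    by_contra hvi
    apply hz
    set w := A⁻¹ *ᵥ extendOption j S z with hw
    have hAw : A *ᵥ w = extendOption j S z := by
      rw [hw, mulVec_mulVec, mul_nonsing_inv _ hA.isUnit, one_mulVec]
    have hwS : ∀ b ∈ S, w b = 0 := fun b hb => by
      have := hN z (some ⟨b, hb⟩)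
      rw [hNz] at this
      exact this.symm
    have hwi : w i = 0 := by
      have := hN z none
      rw [hNz] at this
      exact this.symm
    have hwv : w = z none • v := by
      apply eq_of_mulVec_eq_of_det_ne_zero hB
      rw [mulVec_smul, hv]
      ext a
      by_cases ha : a ∈ S
      · have haj : a ≠ j := fun h => hj (h ▸ ha)
        rw [maskOut_mulVec_of_mem _ ha, hwS a ha]; simp [haj]
      · rw [maskOut_mulVec_of_notMem hwS ha, hAw]
        by_cases haj : a = j <;> simp [extendOption, ha, haj]
    have hz0 : z none = 0 := by
      have := congrFun hwv i
      simpa [hwi, hvi] using this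
    have hE : extendOption j S z = 0 := by
      rw [← hAw, hwv, hz0, zero_smul, mulVec_zero]
    ext k
    cases k with
    | none => exact hz0
    | some s =>
      have hsj : (s : Fin d) ≠ j := fun h => hj (h ▸ s.2)
      simpa [extendOption, hsj] using congrFun hE s
  · intro hvi
    have hE : extendOption j S (fun k => k.elim 1 fun s => (A *ᵥ v) s) = A *ᵥ v := by
      ext a
      by_cases ha : a ∈ S
      · have haj : a ≠ j := fun h => hj (h ▸ ha)
        simp [extendOption, ha, haj]
      · rw [← maskOut_mulVec_of_notMem hvS ha, hv]
        by_cases haj : a = j <;> simp [extendOption, ha, haj]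
    refine ⟨fun k => k.elim 1 fun s => (A *ᵥ v) s, fun h => one_ne_zero (congrFun h none), ?_⟩
    ext k
    rw [hN, hE, mulVec_mulVec, nonsing_inv_mul _ hA.isUnit, one_mulVec]
    cases k with
    | none => exact hvi
    | some s => exact hvS s s.2

/-- Vertices from which `j` can be reached by a walk avoiding `S`. -/
def ReachAvoiding {d : ℕ} (G : SimpleGraph (Fin d)) (S : Finset (Fin d)) (j a : Fin d) : Prop :=
  ∃ p : G.Walk a j, ∀ c ∈ p.support, c ∉ S

lemma separates_singleton_iff {d : ℕ} (G : SimpleGraph (Fin d)) (S : Finset (Fin d))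
    (i j : Fin d) : Separates G {i} {j} ↑S ↔ ¬ ReachAvoiding G S j i := by
  classical
  constructor
  · rintro h ⟨p, hp⟩
    obtain ⟨c, hc, hcp⟩ := h i rfl j rfl p.bypass p.bypass_isPath
    exact hp c (p.support_bypass_subset_support hcp) hc
  · rintro h a rfl b rfl p -
    by_contra! hcon
    exact h ⟨p, fun c hc hcS => hcon c hcS hc⟩

namespace ReachAvoiding

variable {d : ℕ} {G : SimpleGraph (Fin d)} {S : Finset (Fin d)} {j a b : Fin d}

lemma refl (hj : j ∉ S) : ReachAvoiding G S j j := ⟨.nil, by simpa using hj⟩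

lemma notMem (h : ReachAvoiding G S j a) : a ∉ S := h.elim fun p hp => hp a p.start_mem_support

lemma of_adj (h : ReachAvoiding G S j a) (hab : G.Adj b a) (hb : b ∉ S) :
    ReachAvoiding G S j b := by
  obtain ⟨p, hp⟩ := h
  refine ⟨.cons hab p, fun c hc => ?_⟩
  rw [SimpleGraph.Walk.support_cons, List.mem_cons] at hc
  rcases hc with rfl | hc
  exacts [hb, hp c hc]

end ReachAvoiding

lemma eq_zero_of_not_reachAvoiding {d : ℕ} {G : SimpleGraph (Fin d)} {S : Finset (Fin d)}
    {A : Matrix (Fin d) (Fin d) ℝ} (hAG : ∀ a b, a ≠ b → ¬ G.Adj a b → A a b = 0)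
    {i j : Fin d} (hj : j ∉ S) (hB : (maskOut S A).det ≠ 0) {v : Fin d → ℝ}
    (hv : maskOut S A *ᵥ v = Pi.single j 1) (hi : ¬ ReachAvoiding G S j i) : v i = 0 := by
  classical
  have hne : ∀ {a b}, ReachAvoiding G S j a → ¬ ReachAvoiding G S j b → a ≠ b := by
    rintro a b ha hb rfl; exact hb ha
  have key : ∀ a b, (ReachAvoiding G S j a ∧ ¬ ReachAvoiding G S j b) ∨
      (ReachAvoiding G S j b ∧ ¬ ReachAvoiding G S j a) → maskOut S A a b = 0 := by
    intro a b h
    have hab : a ≠ b := by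
      rcases h with h | h
      exacts [hne h.1 h.2, (hne h.1 h.2).symm]
    by_cases hS : a ∈ S ∨ b ∈ S
    · simp [maskOut, hS, hab]
    · have : A a b = 0 := hAG a b hab fun hadj => by
        rw [not_or] at hS
        rcases h with h | h
        exacts [h.2 (h.1.of_adj hadj.symm hS.2), h.2 (h.1.of_adj hadj hS.1)]
      simp [maskOut, hS, this]
  let w : Fin d → ℝ := fun a => if ReachAvoiding G S j a then 0 else v a
  have hw : w = 0 := by
    apply eq_of_mulVec_eq_of_det_ne_zero hB
    rw [mulVec_zero]
    ext a
    by_cases ha : ReachAvoiding G S j a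
    · simp only [mulVec, dotProduct]
      refine Finset.sum_eq_zero fun b _ => ?_
      by_cases hb : ReachAvoiding G S j b
      · simp [w, hb]
      · simp [key a b (.inl ⟨ha, hb⟩)]
    · have haj : a ≠ j := (hne (ReachAvoiding.refl hj) ha).symm
      have : (maskOut S A *ᵥ w) a = (maskOut S A *ᵥ v) a := by
        simp only [mulVec, dotProduct]
        refine Finset.sum_congr rfl fun b _ => ?_
        by_cases hb : ReachAvoiding G S j b
        · simp [key a b (.inr ⟨hb, ha⟩)]
        · simp [w, hb]
      rw [this, hv]; simp [haj]
  have := congrFun hw i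
  simpa [w, hi] using this

section DiagonallyDominant

variable {n : Type*} [Fintype n] {M : Matrix n n ℝ}

lemma nonneg_of_mulVec_nonneg (hoff : ∀ a b, a ≠ b → M a b ≤ 0)
    (hrow : ∀ a, 0 < ∑ b, M a b) {v : n → ℝ} (hv : 0 ≤ M *ᵥ v) : 0 ≤ v := by
  intro c
  obtain ⟨m, hm⟩ := @Finite.exists_min n ℝ _ ⟨c⟩ _ v
  refine le_trans ?_ (hm c)
  by_contra! hneg
  have h1 : (M *ᵥ v) m ≤ (∑ b, M m b) * v m := by
    rw [Finset.sum_mul]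
    refine Finset.sum_le_sum fun b _ => ?_
    by_cases hb : m = b
    · rw [hb]
    · exact mul_le_mul_of_nonpos_left (hm b) (hoff m b hb)
  have h2 := hv m
  have h3 := mul_neg_of_pos_of_neg (hrow m) hneg
  exact absurd (h2.trans h1) (not_le.mpr h3)

lemma det_ne_zero_of_sum_row_pos [DecidableEq n] (hoff : ∀ a b, a ≠ b → M a b ≤ 0)
    (hrow : ∀ a, 0 < ∑ b, M a b) : M.det ≠ 0 := by
  intro h
  obtain ⟨w, hw, hMw⟩ := exists_mulVec_eq_zero_iff.mpr h
  refine hw (le_antisymm ?_ (nonneg_of_mulVec_nonneg hoff hrow hMw.ge))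
  rw [← neg_nonneg]
  exact nonneg_of_mulVec_nonneg hoff hrow (by rw [mulVec_neg, hMw, neg_zero])

lemma mulVec_le_mul_of_eq_zero (hoff : ∀ a b, a ≠ b → M a b ≤ 0) {v : n → ℝ} (hv : 0 ≤ v)
    {a : n} (ha : v a = 0) (b : n) : (M *ᵥ v) a ≤ M a b * v b := by
  classical
  have hterm : ∀ c, M a c * v c ≤ 0 := fun c => by
    by_cases hc : a = c
    · simp [← hc, ha]
    · exact mul_nonpos_of_nonpos_of_nonneg (hoff a c hc) (hv c)
  calc (M *ᵥ v) a = M a b * v b + ∑ c ∈ Finset.univ.erase b, M a c * v c :=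
        (Finset.add_sum_erase _ _ (Finset.mem_univ b)).symm
    _ ≤ M a b * v b := by linarith [Finset.sum_nonpos fun c (_ : c ∈ Finset.univ.erase b) => hterm c]

end DiagonallyDominant

lemma adjugate_maskOut_ne_zero {d g : ℕ} (G : SimpleGraph (Fin d)) (η : Fin g ≃ G.edgeSet)
    {S : Finset (Fin d)} {i j : Fin d} (hi : ReachAvoiding G S j i) :
    (maskOut S (matOf G η (fun _ => d + 1) (fun _ => -1))).adjugate i j ≠ 0 := by
  classical
  set B := maskOut S (matOf G η (fun _ => d + 1) (fun _ => -1)) with hBdef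
  have hoff : ∀ a b, a ≠ b → B a b ≤ 0 := fun a b hab => by
    by_cases hS : a ∈ S ∨ b ∈ S
    · simp [hBdef, maskOut, hS, hab]
    · by_cases hadj : G.Adj a b <;> simp [hBdef, maskOut, hS, hab, matOf, hadj]
  have hrow : ∀ a, 0 < ∑ b, B a b := fun a => by
    by_cases ha : a ∈ S
    · simp [hBdef, maskOut, ha, one_apply]
    · have h1 : ∑ b, ((if a = b then (d + 2 : ℝ) else 0) - 1) ≤ ∑ b, B a b := by
        refine Finset.sum_le_sum fun b _ => ?_
        by_cases hab : a = b
        · subst hab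
          simp [hBdef, maskOut, ha, matOf]; linarith
        · by_cases hb : b ∈ S
          · simp [hBdef, maskOut, hb, hab]
          · by_cases hadj : G.Adj a b <;> simp [hBdef, maskOut, ha, hb, hab, matOf, hadj]
      refine lt_of_lt_of_le ?_ h1
      simp
  have hdet := det_ne_zero_of_sum_row_pos hoff hrow
  set v : Fin d → ℝ := B⁻¹ *ᵥ Pi.single j 1 with hvdef
  have hv : B *ᵥ v = Pi.single j 1 := by
    rw [hvdef, mulVec_mulVec, mul_nonsing_inv _ hdet.isUnit, one_mulVec]
  have hv0 : 0 ≤ v := nonneg_of_mulVec_nonneg hoff hrow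
    (by rw [hv]; exact Pi.single_nonneg.mpr zero_le_one)
  have hpos : ∀ a, ReachAvoiding G S j a → 0 < v a := by
    have hBv : 0 ≤ B *ᵥ v := by rw [hv]; exact Pi.single_nonneg.mpr zero_le_one
    have hvj : 0 < v j := by
      refine lt_of_le_of_ne (hv0 _) fun h => ?_
      have h1 := mulVec_le_mul_of_eq_zero hoff hv0 h.symm j
      rw [hv, ← h, Pi.single_eq_same, mul_zero] at h1
      linarith
    clear_value v
    clear hv hvdef hi
    rintro a ⟨p, hp⟩
    induction p with
    | nil => exact hvj
    | @cons a b c hadj p ih =>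
      have hb : 0 < v b := ih hvj fun c hc => hp c (by simp [hc])
      refine lt_of_le_of_ne (hv0 _) fun h => ?_
      have h1 := mulVec_le_mul_of_eq_zero hoff hv0 h.symm b
      have haS : a ∉ S := hp a (by simp)
      have hbS : b ∉ S := hp b (by simp)
      have hab : B a b = -1 := by simp [hBdef, maskOut, haS, hbS, matOf, hadj, hadj.ne]
      have h0 : 0 ≤ (B *ᵥ v) a := hBv a
      rw [hab] at h1
      linarith
  have hvi := hpos i hi
  intro hadj
  have : v i = 0 := by
    simp [hvdef, inv_def, hadj]
  exact hvi.ne' this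

/-- If `f` restricts to a polynomial on every line through a point where it does not vanish, then
its zero set is null. -/
lemma volume_zeros_eq_zero_of_polynomial_on_lines {E : Type*} [NormedAddCommGroup E]
    [NormedSpace ℝ E] [FiniteDimensional ℝ E] [MeasurableSpace E] [BorelSpace E]
    (ν : Measure E) [ν.IsAddHaarMeasure] {f : E → ℝ} (hf : Continuous f) {q : E} (hq : f q ≠ 0)
    (hline : ∀ p, ∃ P : Polynomial ℝ, ∀ t : ℝ, f (q + t • (p - q)) = P.eval t) :
    ν {p | f p = 0} = 0 := by
  have hmeas : MeasurableSet {x : E × ℝ | f (q + x.2 • (x.1 - q)) = 0} :=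
    (isClosed_singleton.preimage (by fun_prop :
      Continuous fun x : E × ℝ => f (q + x.2 • (x.1 - q)))).measurableSet
  have hprod : (ν.prod (volume : Measure ℝ)) {x : E × ℝ | f (q + x.2 • (x.1 - q)) = 0} = 0 := by
    refine Measure.measure_prod_null_of_ae_null hmeas (Filter.Eventually.of_forall fun p => ?_)
    obtain ⟨P, hP⟩ := hline p
    have hP0 : P ≠ 0 := by
      rintro rfl
      exact hq (by simpa using hP 0)
    refine ((Polynomial.finite_setOfPred_isRoot hP0).subset fun t ht => ?_).measure_zero _
    exact (hP t).symm.trans ht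
  rw [← Measure.prod_swap, Measure.map_apply measurable_swap hmeas,
    Measure.measure_prod_null (measurable_swap hmeas)] at hprod
  have hne : ∀ᵐ t : ℝ, t ≠ 0 := by simp [ae_iff]
  obtain ⟨t, ht, ht0⟩ := (hprod.and hne).exists
  have hset : Prod.mk t ⁻¹' (Prod.swap ⁻¹' {x : E × ℝ | f (q + x.2 • (x.1 - q)) = 0}) =
      AffineMap.homothety q t ⁻¹' {p | f p = 0} := by
    ext p
    simp [AffineMap.homothety_apply, add_comm]
  simp only [hset, Pi.zero_apply] at ht
  have himg := Measure.addHaar_image_homothety ν q t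
    (AffineMap.homothety q t ⁻¹' {p | f p = 0})
  rw [ht, mul_zero, Set.image_preimage_eq] at himg
  · exact himg
  · intro p
    refine ⟨AffineMap.homothety q t⁻¹ p, ?_⟩
    simp [AffineMap.homothety_apply, smul_smul, ht0]

lemma exists_polynomial_adjugate_eq_eval {n : Type*} [Fintype n] [DecidableEq n]
    (B D : Matrix n n ℝ) (i j : n) :
    ∃ P : Polynomial ℝ, ∀ t : ℝ, (B + t • D).adjugate i j = P.eval t := by
  refine ⟨(B.map Polynomial.C + (Polynomial.X : Polynomial ℝ) • D.map Polynomial.C).adjugate i j,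
    fun t => ?_⟩
  have h := (Polynomial.evalRingHom t).map_adjugate
    (B.map Polynomial.C + (Polynomial.X : Polynomial ℝ) • D.map Polynomial.C)
  have h2 : (Polynomial.evalRingHom t).mapMatrix
      (B.map Polynomial.C + (Polynomial.X : Polynomial ℝ) • D.map Polynomial.C) = B + t • D := by
    ext a b
    simp [mul_comm t]
  rw [h2] at h
  rw [← h]
  rfl

lemma maskOut_matOf_line {d g : ℕ} (G : SimpleGraph (Fin d)) (η : Fin g ≃ G.edgeSet)
    (S : Finset (Fin d)) (q p : (Fin d → ℝ) × (Fin g → ℝ)) (t : ℝ) :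
    maskOut S (matOf G η (q + t • (p - q)).1 (q + t • (p - q)).2) =
      maskOut S (matOf G η q.1 q.2) +
        t • (maskOut S (matOf G η p.1 p.2) - maskOut S (matOf G η q.1 q.2)) := by
  ext a b
  by_cases hS : a ∈ S ∨ b ∈ S
  · simp [maskOut, hS]
  · by_cases hab : a = b
    · subst hab
      simp_all [maskOut, matOf]
    · by_cases hadj : G.Adj a b <;> simp [maskOut, hS, matOf, hab, hadj]

lemma continuous_maskOut_matOf {d g : ℕ} (G : SimpleGraph (Fin d)) (η : Fin g ≃ G.edgeSet)
    (S : Finset (Fin d)) :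
    Continuous fun p : (Fin d → ℝ) × (Fin g → ℝ) => maskOut S (matOf G η p.1 p.2) := by
  refine continuous_matrix fun a b => ?_
  by_cases hS : a ∈ S ∨ b ∈ S
  · simp only [maskOut, of_apply, hS, if_true]; fun_prop
  · by_cases hab : a = b
    · subst hab
      simp only [maskOut, of_apply, hS, if_false, matOf, if_true]; fun_prop
    · by_cases hadj : G.Adj a b
      · simp only [maskOut, of_apply, hS, if_false, matOf, hab, hadj, dif_pos]; fun_prop
      · simp only [maskOut, of_apply, hS, if_false, matOf, hab, hadj, dif_neg, not_false_eq_true]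
        fun_prop

lemma volume_adjugate_maskOut_eq_zero {d g : ℕ} (G : SimpleGraph (Fin d))
    (η : Fin g ≃ G.edgeSet) {S : Finset (Fin d)} {i j : Fin d} (hi : ReachAvoiding G S j i) :
    volume {p : (Fin d → ℝ) × (Fin g → ℝ) |
      (maskOut S (matOf G η p.1 p.2)).adjugate i j = 0} = 0 := by
  have hcont : Continuous fun p : (Fin d → ℝ) × (Fin g → ℝ) =>
      (maskOut S (matOf G η p.1 p.2)).adjugate i j :=
    (continuous_maskOut_matOf G η S).matrix_adjugate.matrix_elem i j
  have hline : ∀ p q : (Fin d → ℝ) × (Fin g → ℝ), ∃ P : Polynomial ℝ, ∀ t : ℝ,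
      (maskOut S (matOf G η (q + t • (p - q)).1 (q + t • (p - q)).2)).adjugate i j =
        P.eval t := fun p q => by
    simp only [maskOut_matOf_line]
    exact exists_polynomial_adjugate_eq_eval _ _ i j
  have hH : (volume : Measure ((Fin d → ℝ) × (Fin g → ℝ))).IsAddHaarMeasure := by
    have h1 : (volume : Measure (Fin d → ℝ)).IsAddHaarMeasure := inferInstance
    have h2 : (volume : Measure (Fin g → ℝ)).IsAddHaarMeasure := inferInstance
    exact Measure.prod.instIsAddHaarMeasure volume volume
  have hq := adjugate_maskOut_ne_zero G η hi
  exact volume_zeros_eq_zero_of_polynomial_on_lines _ hcont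
    (q := (fun _ => (d + 1 : ℝ), fun _ => -1)) hq fun p => hline p _

lemma isPerfect_inv_of_adjugate_ne_zero {d : ℕ} {G : SimpleGraph (Fin d)}
    {A : Matrix (Fin d) (Fin d) ℝ} (hA : A.PosDef)
    (hAG : ∀ a b, a ≠ b → ¬ G.Adj a b → A a b = 0)
    (hadj : ∀ (i j : Fin d) (S : Finset (Fin d)), ReachAvoiding G S j i →
      (maskOut S A).adjugate i j ≠ 0) : IsPerfect G A⁻¹ := by
  intro i j _ S _ hj
  have hB : (maskOut S A).det ≠ 0 := det_maskOut_ne_zero hA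
  have hv : maskOut S A *ᵥ ((maskOut S A)⁻¹ *ᵥ Pi.single j 1) = Pi.single j 1 := by
    rw [mulVec_mulVec, mul_nonsing_inv _ hB.isUnit, one_mulVec]
  rw [subDet_inv_eq_zero_iff_s1 hA.det_pos.ne' hj hB hv, separates_singleton_iff]
  refine ⟨fun h hr => hadj i j S hr ?_, eq_zero_of_not_reachAvoiding hAG hj hB hv⟩
  simpa [inv_def, hB] using h

/-- if `μ` is a probability distribution on `ℝ^d × ℝ^g ≅ ℝ^{g+d}`, absolutely
continuous w.r.t. Lebesgue measure, whose induced distribution on symmetric matrices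
(diagonal from the first `d` coordinates, edge entries from the last `g`) is concentrated
on positive definite matrices with support exactly `G°`, then `μ`-almost surely the inverse
matrix `Σ` is perfect w.r.t. `G`. -/
theorem statement1 {d g : ℕ} (G : SimpleGraph (Fin d)) (η : Fin g ≃ G.edgeSet)
    (μ : Measure ((Fin d → ℝ) × (Fin g → ℝ))) [IsProbabilityMeasure μ]
    (habs : μ ≪ volume)
    (hconc : μ {p : (Fin d → ℝ) × (Fin g → ℝ) |
      ¬ ((matOf G η p.1 p.2).PosDef ∧ ∀ k, p.2 k ≠ 0)} = 0) :
    μ {p : (Fin d → ℝ) × (Fin g → ℝ) |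
      ¬ IsPerfect G (matOf G η p.1 p.2)⁻¹} = 0 := by
  have hvol : ∀ᵐ p ∂μ, ∀ (i j : Fin d) (S : Finset (Fin d)), ReachAvoiding G S j i →
      (maskOut S (matOf G η p.1 p.2)).adjugate i j ≠ 0 := by
    suffices h : ∀ᵐ p ∂(volume : Measure ((Fin d → ℝ) × (Fin g → ℝ))), ∀ (i j : Fin d)
        (S : Finset (Fin d)), ReachAvoiding G S j i →
        (maskOut S (matOf G η p.1 p.2)).adjugate i j ≠ 0 from habs.ae_le h
    simp only [ae_all_iff]
    intro i j S hi
    rw [ae_iff]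
    simpa only [ne_eq, not_not] using volume_adjugate_maskOut_eq_zero G η hi
  have hpd : ∀ᵐ p ∂μ, (matOf G η p.1 p.2).PosDef ∧ ∀ k, p.2 k ≠ 0 := ae_iff.mpr hconc
  refine ae_iff.mp (?_ : ∀ᵐ p ∂μ, IsPerfect G (matOf G η p.1 p.2)⁻¹)
  filter_upwards [hvol, hpd] with p hp hA
  refine isPerfect_inv_of_adjugate_ne_zero hA.1 (fun a b hab hnadj => ?_) hp
  simp [matOf, hab, hnadj]
end

section
/- Let G be an undirected simple graph on [d] with g = |E| ≥ 2 edges, and let S^E_∞ := {δ ∈ ℝ^E : ‖δ‖_∞ = 1}. Then the set S^E_∞ ∩ D^c, where D^c := [-1,1]_*^E ∖ D, has (g−1)-dimensional Hausdorff measure zero (as a subset of ℝ^g under the identification ℝ^E ≅ ℝ^g). -/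
open MeasureTheory

open Classical in
/-- The value of `δ ∈ ℝ^E` on the edge `e` of `G` (and `0` off the edge set), where `η`
enumerates the edges of `G`. -/
noncomputable def edgeWeight {d g : ℕ} (G : SimpleGraph (Fin d)) (η : Fin g ≃ G.edgeSet)
    (δ : Fin g → ℝ) (e : Sym2 (Fin d)) : ℝ :=
  if h : e ∈ G.edgeSet then δ (η.symm ⟨e, h⟩) else 0

/-- For a walk `Π` in `G`, the product `δ_Π = ∏_{ℓ} δ_{i_ℓ i_{ℓ+1}}` over the edges of the
walk. -/
noncomputable def walkWeight {d g : ℕ} (G : SimpleGraph (Fin d)) (η : Fin g ≃ G.edgeSet)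
    (δ : Fin g → ℝ) {i j : Fin d} (p : G.Walk i j) : ℝ :=
  (p.edges.map (edgeWeight G η δ)).prod

/-- The sum `∑_{Π ∈ P_t^{ij}(G)} δ_Π` over all `ij`-paths of `G` of length `t+1`. -/
noncomputable def pathSum {d g : ℕ} (G : SimpleGraph (Fin d)) (η : Fin g ≃ G.edgeSet)
    (δ : Fin g → ℝ) (i j : Fin d) (t : ℕ) : ℝ :=
  ∑ᶠ p ∈ {p : G.Walk i j | p.IsPath ∧ p.length = t + 1}, walkWeight G η δ p

/-- Membership of `δ ∈ ℝ^E ≅ ℝ^g` in the set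
`D = {δ ∈ [-1,1]_*^E : ∑_{Π ∈ P_t^{ij}(G)} δ_Π ≠ 0 for all nonempty P_t^{ij}(G), ij ∈ E,
0 ≤ t < d}`. -/
def memD {d g : ℕ} (G : SimpleGraph (Fin d)) (η : Fin g ≃ G.edgeSet) (δ : Fin g → ℝ) : Prop :=
  (∀ k, δ k ∈ Set.Icc (-1 : ℝ) 1 ∧ δ k ≠ 0) ∧
  ∀ i j : Fin d, G.Adj i j → ∀ t : ℕ, t < d →
    {p : G.Walk i j | p.IsPath ∧ p.length = t + 1}.Nonempty → pathSum G η δ i j t ≠ 0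

/-- The zero set of a nonzero real polynomial in `n` variables is Lebesgue null. -/
theorem MvPolynomial.volume_zeros_eq_zero {n : ℕ} {p : MvPolynomial (Fin n) ℝ} (hp : p ≠ 0) :
    volume {x : Fin n → ℝ | MvPolynomial.eval x p = 0} = 0 := by
  induction n with
  | zero =>
    suffices h : {x : Fin 0 → ℝ | MvPolynomial.eval x p = 0} = ∅ by rw [h, measure_empty]
    refine Set.eq_empty_of_forall_notMem fun x hx => hp (MvPolynomial.funext fun y => ?_)
    rw [map_zero, Subsingleton.elim y x]
    exact hx
  | succ n ih =>
    have hF : MvPolynomial.finSuccEquiv ℝ n p ≠ 0 := by simpa using hp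
    have hmeas : MeasurableSet {x : Fin (n + 1) → ℝ | MvPolynomial.eval x p = 0} :=
      (isClosed_eq (MvPolynomial.continuous_eval p) continuous_const).measurableSet
    have hmp := (volume_preserving_piFinSuccAbove (fun _ : Fin (n + 1) => ℝ) 0).symm
    rw [← hmp.measure_preimage hmeas.nullMeasurableSet, Measure.volume_eq_prod,
      Measure.measure_prod_null (hmp.measurable hmeas)]
    have hfin : {s : ℝ | (MvPolynomial.finSuccEquiv ℝ n p).IsRoot (MvPolynomial.C s)}.Finite :=
      (Polynomial.finite_setOfPred_isRoot hF).preimage (MvPolynomial.C_injective _ _).injOn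
    filter_upwards [measure_eq_zero_iff_ae_notMem.mp (hfin.measure_zero volume)] with s hs
    rw [Pi.zero_apply, ← ih hs]
    congr 1
    ext y
    simp [MvPolynomial.eval_polynomial_eval_finSuccEquiv, MeasurableEquiv.piFinSuccAbove,
      Fin.insertNthEquiv]
    rfl

/-- The zeros of a polynomial function on the hyperplane `{δ | δ k = ε}` of `ℝ^(n+1)` are null
for the `n`-dimensional Hausdorff measure, provided that some point of it is not a zero. -/
theorem hausdorffMeasure_hyperplane_zeros_eq_zero {n : ℕ} (k : Fin (n + 1)) (ε : ℝ)
    (P : MvPolynomial (Fin (n + 1)) ℝ) {a : Fin (n + 1) → ℝ} (hak : a k = ε)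
    (ha : MvPolynomial.eval a P ≠ 0) :
    μH[n] {δ : Fin (n + 1) → ℝ | δ k = ε ∧ MvPolynomial.eval δ P = 0} = 0 := by
  let q : MvPolynomial (Fin n) ℝ :=
    MvPolynomial.bind₁ (k.insertNth (MvPolynomial.C ε) MvPolynomial.X) P
  have hq (x : Fin n → ℝ) :
      MvPolynomial.eval x q = MvPolynomial.eval (k.insertNth ε x : Fin (n + 1) → ℝ) P := by
    change MvPolynomial.eval₂Hom _ _ (MvPolynomial.bind₁ _ P) = MvPolynomial.eval₂Hom _ _ P
    rw [MvPolynomial.eval₂Hom_bind₁]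
    congr 2
    ext i
    refine k.succAboveCases ?_ (fun j => ?_) i <;> simp
  have hq0 : q ≠ 0 := by
    intro h
    apply ha
    have := hq (k.removeNth a)
    rwa [h, map_zero, ← hak, Fin.insertNth_self_removeNth, eq_comm] at this
  have hiso : Isometry (fun x : Fin n → ℝ => (k.insertNth ε x : Fin (n + 1) → ℝ)) :=
    Isometry.of_dist_eq fun x y => by simp [Fin.dist_insertNth_insertNth]
  have himage : {δ : Fin (n + 1) → ℝ | δ k = ε ∧ MvPolynomial.eval δ P = 0} ⊆
      (fun x : Fin n → ℝ => (k.insertNth ε x : Fin (n + 1) → ℝ)) ''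
        {x | MvPolynomial.eval x q = 0} := by
    rintro δ ⟨rfl, hδ⟩
    exact ⟨k.removeNth δ, by simpa [hq] using hδ, by simp⟩
  refine measure_mono_null himage ?_
  have hpi := hausdorffMeasure_pi_real (ι := Fin n)
  rw [Fintype.card_fin] at hpi
  rw [hiso.hausdorffMeasure_image (Or.inl n.cast_nonneg), hpi]
  exact MvPolynomial.volume_zeros_eq_zero hq0

theorem SimpleGraph.finite_setOf_isPath_length_eq {d : ℕ} (G : SimpleGraph (Fin d))
    (i j : Fin d) (l : ℕ) : {p : G.Walk i j | p.IsPath ∧ p.length = l}.Finite := by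
  classical
  exact (Set.toFinite {p : G.Walk i j | p.length = l}).subset fun p hp => hp.2

theorem exists_eval_eq_pathSum {d g : ℕ} (G : SimpleGraph (Fin d)) (η : Fin g ≃ G.edgeSet)
    (i j : Fin d) (t : ℕ) :
    ∃ P : MvPolynomial (Fin g) ℝ, ∀ δ, MvPolynomial.eval δ P = pathSum G η δ i j t := by
  classical
  refine ⟨∑ p ∈ (G.finite_setOf_isPath_length_eq i j (t + 1)).toFinset,
    (p.edges.map fun e =>
      if h : e ∈ G.edgeSet then MvPolynomial.X (η.symm ⟨e, h⟩) else 0).prod, fun δ => ?_⟩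
  rw [pathSum, finsum_mem_eq_finite_toFinset_sum _ (G.finite_setOf_isPath_length_eq i j (t + 1)),
    map_sum]
  refine Finset.sum_congr rfl fun p _ => ?_
  rw [walkWeight, map_list_prod, List.map_map]
  congr 2
  ext e
  by_cases h : e ∈ G.edgeSet <;> simp [edgeWeight, h]

theorem walkWeight_const {d g : ℕ} (G : SimpleGraph (Fin d)) (η : Fin g ≃ G.edgeSet) (c : ℝ)
    {i j : Fin d} (p : G.Walk i j) : walkWeight G η (fun _ => c) p = c ^ p.length := by
  rw [walkWeight, List.map_congr_left (g := fun _ => c) fun e he => by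
    simp [edgeWeight, p.edges_subset_edgeSet he]]
  simp

theorem pathSum_const_ne_zero {d g : ℕ} (G : SimpleGraph (Fin d)) (η : Fin g ≃ G.edgeSet)
    {c : ℝ} (hc : c ≠ 0) {i j : Fin d} {t : ℕ}
    (h : {p : G.Walk i j | p.IsPath ∧ p.length = t + 1}.Nonempty) :
    pathSum G η (fun _ => c) i j t ≠ 0 := by
  have hfin := G.finite_setOf_isPath_length_eq i j (t + 1)
  rw [pathSum, finsum_mem_eq_finite_toFinset_sum _ hfin,
    Finset.sum_congr rfl (g := fun _ => c ^ (t + 1)) fun p hp => by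
      rw [walkWeight_const, (hfin.mem_toFinset.mp hp).2],
    Finset.sum_const, nsmul_eq_mul]
  refine mul_ne_zero (Nat.cast_ne_zero.mpr ?_) (pow_ne_zero _ hc)
  exact (Finset.card_pos.mpr (hfin.toFinset_nonempty.mpr h)).ne'

/-- Some coordinate of a point of the unit sphere of the sup norm has absolute value `1`. -/
theorem exists_eq_one_or_neg_one_of_norm_eq_one {ι : Type*} [Fintype ι] {δ : ι → ℝ}
    (h : ‖δ‖ = 1) : ∃ k, δ k = 1 ∨ δ k = -1 := by
  by_contra! hne
  have : ‖δ‖ < 1 := (pi_norm_lt_iff one_pos).mpr fun k =>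
    lt_of_le_of_ne (h ▸ norm_le_pi_norm δ k) fun hk => by
      rcases eq_or_eq_neg_of_abs_eq hk with hk | hk
      exacts [(hne k).1 hk, (hne k).2 hk]
  exact this.ne h

/-- for a simple graph `G` on `[d]` with `g ≥ 2` edges (enumerated by `η`), the
set `S^E_∞ ∩ Dᶜ` (where `S^E_∞` is the unit sphere of the sup norm, and
`Dᶜ = [-1,1]_*^E \ D`), viewed as a subset of `ℝ^g`, has `(g-1)`-dimensional Hausdorff
measure zero. -/
theorem statement3 {d g : ℕ} (G : SimpleGraph (Fin d)) (η : Fin g ≃ G.edgeSet) (hg : 2 ≤ g) :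
    μH[(g : ℝ) - 1] {δ : Fin g → ℝ | ‖δ‖ = 1 ∧
      (∀ k, δ k ∈ Set.Icc (-1 : ℝ) 1 ∧ δ k ≠ 0) ∧ ¬ memD G η δ} = 0 := by
  obtain ⟨n, rfl⟩ : ∃ n, g = n + 1 := ⟨g - 1, by omega⟩
  have hface (k : Fin (n + 1)) (i j : Fin d) (t : ℕ)
      (h : {p : G.Walk i j | p.IsPath ∧ p.length = t + 1}.Nonempty) {ε : ℝ} (hε : ε ≠ 0) :
      μH[n] {δ : Fin (n + 1) → ℝ | δ k = ε ∧ pathSum G η δ i j t = 0} = 0 := by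
    obtain ⟨P, hP⟩ := exists_eval_eq_pathSum G η i j t
    simp only [← hP]
    refine hausdorffMeasure_hyperplane_zeros_eq_zero k ε P (a := fun _ => ε) rfl ?_
    rw [hP]
    exact pathSum_const_ne_zero G η hε h
  rw [Nat.cast_succ, add_sub_cancel_right]
  refine measure_mono_null (t := ⋃ (k : Fin (n + 1)) (i : Fin d) (j : Fin d) (t : ℕ)
    (_ : {p : G.Walk i j | p.IsPath ∧ p.length = t + 1}.Nonempty),
    {δ : Fin (n + 1) → ℝ | δ k = 1 ∧ pathSum G η δ i j t = 0} ∪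
      {δ | δ k = -1 ∧ pathSum G η δ i j t = 0}) ?_ ?_
  · rintro δ ⟨hnorm, hmem, hD⟩
    obtain ⟨k, hk⟩ := exists_eq_one_or_neg_one_of_norm_eq_one hnorm
    have hzero : ∃ i j : Fin d, ∃ t : ℕ,
        {p : G.Walk i j | p.IsPath ∧ p.length = t + 1}.Nonempty ∧ pathSum G η δ i j t = 0 := by
      by_contra! hne
      exact hD ⟨hmem, fun i j _ t _ h => hne i j t h⟩
    obtain ⟨i, j, t, h, h0⟩ := hzero
    simp only [Set.mem_iUnion]
    exact ⟨k, i, j, t, h, hk.imp (⟨·, h0⟩) (⟨·, h0⟩)⟩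
  · simp only [measure_iUnion_null_iff]
    exact fun k i j t h => measure_union_null (hface k i j t h one_ne_zero)
      (hface k i j t h (neg_ne_zero.mpr one_ne_zero))
end

section
/- Let H be a directed graph on [r] with no self-loops except possibly at vertex 1, and let B(x) be the associated matrix over ℂ[x] built from nonzero reals δ_{i,j}. If C_t^1(H) = ∅ for every t ≥ 0, then det B(x) is the zero polynomial in ℂ[x]. -/
/-- `c : Fin (t+1) → Fin r` is a 1-cycle of length `t+1` in the directed graph `H` based at
the vertex `v₁`: a sequence `v₁ = i_0 → i_1 → ⋯ → i_t → i_0` of distinct vertices all of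
whose consecutive ordered pairs (cyclically) are edges of `H`. -/
def IsOneCycle {r : ℕ} (H : Set (Fin r × Fin r)) (v₁ : Fin r) {t : ℕ}
    (c : Fin (t + 1) → Fin r) : Prop :=
  c 0 = v₁ ∧ Function.Injective c ∧ ∀ ℓ : Fin (t + 1), (c ℓ, c (ℓ + 1)) ∈ H

open Classical in
/-- The matrix `B(x)` over `ℂ[x]`: `b_{i,i} = 1` for `i ≠ v₁`, and otherwise (for `i ≠ j` as
well as for `i = j = v₁`) `b_{i,j} = δ_{i,j}·x` if `(i,j) ∈ H` and `b_{i,j} = 0` if not. -/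
noncomputable def Bmat {r : ℕ} (H : Set (Fin r × Fin r)) (v₁ : Fin r)
    (δ : Fin r → Fin r → ℝ) : Matrix (Fin r) (Fin r) (Polynomial ℂ) :=
  fun i j => if i = j ∧ i ≠ v₁ then 1
    else if (i, j) ∈ H then Polynomial.C (δ i j : ℂ) * Polynomial.X else 0

/-- If a permutation maps `v` along edges of `H` at every point of its orbit, the orbit is a
1-cycle based at `v`. -/
theorem exists_isOneCycle_of_perm {r : ℕ} {H : Set (Fin r × Fin r)} {v : Fin r}
    (σ : Equiv.Perm (Fin r)) (h : ∀ n : ℕ, (σ^[n] v, σ^[n + 1] v) ∈ H) :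
    ∃ (t : ℕ) (c : Fin (t + 1) → Fin r), IsOneCycle H v c := by
  have hpos : 0 < Function.minimalPeriod σ v :=
    Function.minimalPeriod_pos_of_mem_periodicPts (σ.injective.mem_periodicPts v)
  obtain ⟨t, ht⟩ := Nat.exists_eq_succ_of_ne_zero hpos.ne'
  refine ⟨t, fun ℓ => σ^[(ℓ : ℕ)] v, rfl, fun a b hab => Fin.ext ?_, fun ℓ => ?_⟩
  · exact Function.iterate_injOn_Iio_minimalPeriod (f := σ) (x := v)
      (by simpa [ht] using a.is_lt) (by simpa [ht] using b.is_lt) hab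
  · have hℓ := h ℓ
    rcases eq_or_ne ℓ (Fin.last t) with rfl | hne
    · have hper : σ^[t + 1] v = v := by
        simpa [ht] using Function.iterate_minimalPeriod (f := σ) (x := v)
      simpa only [Fin.val_last, hper, Fin.last_add_one, Fin.val_zero, Function.iterate_zero_apply]
        using hℓ
    · simpa only [Fin.val_add_one_of_lt (Fin.lt_last_iff_ne_last.mpr hne)] using hℓ

/-- A nonzero entry `b_{i,j}` off the diagonal, or at `i = j = v`, comes from an edge of `H`. -/
theorem mem_of_Bmat_ne_zero {r : ℕ} {H : Set (Fin r × Fin r)} {v : Fin r}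
    {δ : Fin r → Fin r → ℝ} {i j : Fin r} (h : Bmat H v δ i j ≠ 0) (hij : i = j → i = v) :
    (i, j) ∈ H := by
  by_contra hH
  exact h (by rw [Bmat, if_neg (fun hd => hd.2 (hij hd.1)), if_neg hH])

/-- Lemma (a): let `H` be a directed graph on `[r]` with no self-loops except
possibly at the vertex `1`, and let `B(x)` be the associated matrix over `ℂ[x]` built from
nonzero reals `δ_{i,j}`. If `C_t^1(H) = ∅` for all `t ≥ 0`, then `det B(x) = 0` in `ℂ[x]`. -/
theorem statement7 {r : ℕ} (hr : 0 < r) (H : Set (Fin r × Fin r))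
    (hloop : ∀ i : Fin r, (i, i) ∈ H → i = ⟨0, hr⟩)
    (δ : Fin r → Fin r → ℝ) (hδ : ∀ i j, δ i j ≠ 0)
    (hcyc : ∀ t : ℕ, ¬ ∃ c : Fin (t + 1) → Fin r, IsOneCycle H ⟨0, hr⟩ c) :
    (Bmat H ⟨0, hr⟩ δ).det = 0 := by
  rw [← Matrix.det_transpose, Matrix.det_apply]
  refine Finset.sum_eq_zero fun σ _ => ?_
  by_contra hσ
  have hprod : ∏ i, Bmat H ⟨0, hr⟩ δ i (σ i) ≠ 0 := fun h0 => hσ (by simp [h0])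
  have hentry := fun i => Finset.prod_ne_zero_iff.mp hprod i (Finset.mem_univ i)
  obtain ⟨t, ht⟩ := exists_isOneCycle_of_perm (H := H) (v := ⟨0, hr⟩) σ fun n => by
    have hn := hentry (σ^[n] ⟨0, hr⟩)
    rw [← Function.iterate_succ_apply' (⇑σ)] at hn
    refine mem_of_Bmat_ne_zero hn fun heq => ?_
    rw [Function.iterate_succ_apply] at heq
    exact Function.iterate_fixed ((σ.injective.iterate n) heq).symm n
  exact hcyc t ht
end

section
/- Let H be a directed graph on [r] with no self-loops except possibly at vertex 1, and let B(x) be the associated matrix over ℂ[x] built from nonzero reals δ_{i,j}. Assume that for every 0 ≤ t < r with C_t^1(H) ≠ ∅, the sum ∑_{C ∈ C_t^1(H)} δ_C is nonzero. If det B(x) is the zero polynomial in ℂ[x], then C_t^1(H) = ∅ for every t ≥ 0. -/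
/-- For a cycle `C = (i_0, …, i_t)` (with `i_{t+1} := i_0`), the product
`δ_C = ∏_{ℓ=0}^t δ_{i_ℓ, i_{ℓ+1}}`. -/
def cycleWeight {r t : ℕ} (δ : Fin r → Fin r → ℝ) (c : Fin (t + 1) → Fin r) : ℝ :=
  ∏ ℓ : Fin (t + 1), δ (c ℓ) (c (ℓ + 1))

/-- The permutation of the vertices which rotates an injective cycle `c` by one step and fixes
every vertex off `c`. -/
noncomputable def cyclePerm {r t : ℕ} (c : Fin (t + 1) → Fin r) (hc : Function.Injective c) :
    Equiv.Perm (Fin r) :=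
  (finRotate (t + 1)).viaFintypeEmbedding ⟨c, hc⟩

section CyclePerm

variable {r t : ℕ} {c : Fin (t + 1) → Fin r} (hc : Function.Injective c)

lemma cyclePerm_apply (ℓ : Fin (t + 1)) : cyclePerm c hc (c ℓ) = c (ℓ + 1) := by
  have := (finRotate (t + 1)).viaFintypeEmbedding_apply_image ⟨c, hc⟩ ℓ
  rw [finRotate_apply] at this
  exact this

lemma cyclePerm_apply_of_notMem_range {i : Fin r} (hi : i ∉ Set.range c) :
    cyclePerm c hc i = i :=
  (finRotate (t + 1)).viaFintypeEmbedding_apply_notMem_range ⟨c, hc⟩ hi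

lemma sign_cyclePerm : Equiv.Perm.sign (cyclePerm c hc) = (-1) ^ t := by
  rw [cyclePerm, Equiv.Perm.viaFintypeEmbedding_sign, sign_finRotate, Nat.add_sub_cancel]

end CyclePerm

lemma cyclePerm_injective {r t : ℕ} (H : Set (Fin r × Fin r)) (v : Fin r) :
    Function.Injective fun c : {c : Fin (t + 1) → Fin r // IsOneCycle H v c} =>
      cyclePerm c.1 c.2.2.1 := by
  rintro ⟨c, hc⟩ ⟨d, hd⟩ h
  have h : cyclePerm c hc.2.1 = cyclePerm d hd.2.1 := h
  refine Subtype.ext (funext fun ℓ => ?_)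
  change c ℓ = d ℓ
  induction ℓ using Fin.induction with
  | zero => rw [hc.1, hd.1]
  | succ i ih =>
    rw [← Fin.coeSucc_eq_succ, ← cyclePerm_apply hc.2.1, ← cyclePerm_apply hd.2.1, ih, h]

lemma Bmat_of_mem {r : ℕ} {H : Set (Fin r × Fin r)} {v : Fin r}
    (hloop : ∀ i : Fin r, (i, i) ∈ H → i = v) (δ : Fin r → Fin r → ℝ) {i j : Fin r}
    (h : (i, j) ∈ H) : Bmat H v δ i j = Polynomial.C (δ i j : ℂ) * Polynomial.X := by
  have h' : ¬ (i = j ∧ i ≠ v) := by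
    rintro ⟨rfl, hv⟩
    exact hv (hloop i h)
  rw [Bmat, if_neg h', if_pos h]

/-- The term of a cycle permutation in the expansion of `det B(x)`. -/
lemma prod_Bmat_cyclePerm {r t : ℕ} {H : Set (Fin r × Fin r)} {v : Fin r}
    (hloop : ∀ i : Fin r, (i, i) ∈ H → i = v) (δ : Fin r → Fin r → ℝ)
    {c : Fin (t + 1) → Fin r} (hc : IsOneCycle H v c) :
    ∏ i, Bmat H v δ i (cyclePerm c hc.2.1 i) =
      Polynomial.C (cycleWeight δ c : ℂ) * Polynomial.X ^ (t + 1) := by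
  rw [← Fintype.prod_of_injective c hc.2.1
    (fun ℓ => Polynomial.C (δ (c ℓ) (c (ℓ + 1)) : ℂ) * Polynomial.X)]
  · simp [Finset.prod_mul_distrib, cycleWeight]
  · intro i hi
    rw [cyclePerm_apply_of_notMem_range _ hi, Bmat, if_pos]
    exact ⟨rfl, fun hv => hi ⟨0, hc.1.trans hv.symm⟩⟩
  · intro ℓ
    rw [cyclePerm_apply, Bmat_of_mem hloop δ (hc.2.2 ℓ)]

open Classical in
lemma prod_Bmat_perm {r : ℕ} {H : Set (Fin r × Fin r)} {v : Fin r} {δ : Fin r → Fin r → ℝ}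
    {σ : Equiv.Perm (Fin r)} (h : ∀ i, Bmat H v δ i (σ i) ≠ 0) :
    ∃ a : ℂ, ∏ i, Bmat H v δ i (σ i) =
      Polynomial.C a * Polynomial.X ^ (Finset.univ.filter fun i => ¬ (i = σ i ∧ i ≠ v)).card := by
  have hB : ∀ i, Bmat H v δ i (σ i) =
      if i = σ i ∧ i ≠ v then 1 else Polynomial.C (δ i (σ i) : ℂ) * Polynomial.X := by
    intro i
    have hi := h i
    unfold Bmat at hi ⊢
    split_ifs at hi ⊢ <;> first | rfl | exact absurd rfl hi
  simp_rw [hB]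
  rw [Finset.prod_ite, Finset.prod_const_one, one_mul, Finset.prod_mul_distrib,
    Finset.prod_const, ← map_prod]
  exact ⟨_, rfl⟩

/-- The orbit of `v` under a permutation `σ`, listed from `v`. -/
lemma exists_orbit_enumeration {r : ℕ} (σ : Equiv.Perm (Fin r)) (v : Fin r) :
    ∃ (s : ℕ) (c : Fin (s + 1) → Fin r),
      c 0 = v ∧ Function.Injective c ∧ ∀ ℓ, σ (c ℓ) = c (ℓ + 1) := by
  have hpos : 0 < Function.minimalPeriod σ v :=
    Function.minimalPeriod_pos_of_mem_periodicPts (σ.injective.mem_periodicPts v)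
  obtain ⟨s, hs⟩ := Nat.exists_eq_succ_of_ne_zero hpos.ne'
  refine ⟨s, fun ℓ => σ^[ℓ] v, rfl, ?_, ?_⟩
  · intro a b hab
    exact Fin.ext (Function.iterate_injOn_Iio_minimalPeriod
      (by simp [hs]; omega) (by simp [hs]; omega) hab)
  · intro ℓ
    have hℓ : ((ℓ + 1 : Fin (s + 1)) : ℕ) = (ℓ + 1) % Function.minimalPeriod σ v := by
      rw [hs, Fin.val_add]
      simp
    simp only [hℓ, Function.iterate_mod_minimalPeriod_eq, Function.iterate_succ_apply']

/-- If no `1`-cycle is shorter than `t + 1`, only the permutations of `1`-cycles of length `t + 1`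
contribute to the coefficient of `x ^ (t + 1)`. -/
lemma coeff_prod_Bmat_eq_zero {r t : ℕ} {H : Set (Fin r × Fin r)} {v : Fin r}
    (δ : Fin r → Fin r → ℝ)
    (hmin : ∀ s < t, ¬ ∃ c : Fin (s + 1) → Fin r, IsOneCycle H v c)
    {σ : Equiv.Perm (Fin r)}
    (hσ : ∀ (c : Fin (t + 1) → Fin r) (hc : IsOneCycle H v c), cyclePerm c hc.2.1 ≠ σ) :
    (∏ i, Bmat H v δ i (σ i)).coeff (t + 1) = 0 := by
  classical
  by_contra hcoeff
  have hB : ∀ i, Bmat H v δ i (σ i) ≠ 0 := by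
    intro i hi
    rw [Finset.prod_eq_zero (Finset.mem_univ i) hi] at hcoeff
    simp at hcoeff
  have hedge : ∀ i, i = v ∨ i ≠ σ i → (i, σ i) ∈ H := by
    intro i hi
    have h := hB i
    unfold Bmat at h
    split_ifs at h with h1 h2
    · tauto
    · exact h2
    · exact absurd rfl h
  obtain ⟨a, ha⟩ := prod_Bmat_perm hB
  set D := Finset.univ.filter fun i => ¬ (i = σ i ∧ i ≠ v) with hD
  have hcard : D.card = t + 1 := by
    rw [ha, Polynomial.coeff_C_mul, Polynomial.coeff_X_pow] at hcoeff
    by_contra hne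
    simp [Ne.symm hne] at hcoeff
  obtain ⟨s, c, hc0, hcinj, hcσ⟩ := exists_orbit_enumeration σ v
  have hcD : ∀ ℓ, c ℓ ∈ D := by
    intro ℓ
    rw [hD, Finset.mem_filter]
    refine ⟨Finset.mem_univ _, ?_⟩
    rintro ⟨hfix, hv⟩
    apply hv
    have h1 : ℓ = ℓ + 1 := hcinj (hfix.trans (hcσ ℓ))
    have hs : s = 0 := by
      by_contra hs
      have : NeZero s := ⟨hs⟩
      simp at h1
    subst hs
    rw [← hc0, Fin.ext (by omega : (ℓ : ℕ) = (0 : Fin 1))]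
  have hcyc : IsOneCycle H v c := by
    refine ⟨hc0, hcinj, fun ℓ => ?_⟩
    rw [← hcσ]
    apply hedge
    have := hcD ℓ
    simp only [hD, Finset.mem_filter] at this
    tauto
  have hts : t ≤ s := not_lt.mp fun h => hmin s h ⟨c, hcyc⟩
  have hsub : Finset.univ.image c ⊆ D := by
    intro i hi
    obtain ⟨ℓ, -, rfl⟩ := Finset.mem_image.mp hi
    exact hcD ℓ
  have hcardc : (Finset.univ.image c).card = s + 1 := by
    rw [Finset.card_image_of_injective _ hcinj, Finset.card_fin]
  have hst : s = t := by
    have := Finset.card_le_card hsub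
    omega
  subst hst
  have himage := Finset.eq_of_subset_of_card_le hsub (by omega)
  refine hσ c hcyc (Equiv.ext fun i => ?_)
  by_cases hi : i ∈ Set.range c
  · obtain ⟨ℓ, rfl⟩ := hi
    rw [cyclePerm_apply, hcσ]
  · rw [cyclePerm_apply_of_notMem_range _ hi]
    have hiD : i ∉ D := by
      rw [← himage]
      simpa using hi
    simp only [hD, Finset.mem_filter, Finset.mem_univ, true_and, not_not] at hiD
    exact hiD.1

/-- If no `1`-cycle is shorter than `t + 1`, the coefficient of `x ^ (t + 1)` in `det B(x)` is, up
to sign, the total weight of the `1`-cycles of length `t + 1`. -/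
lemma coeff_det_Bmat {r t : ℕ} {H : Set (Fin r × Fin r)} {v : Fin r}
    (hloop : ∀ i : Fin r, (i, i) ∈ H → i = v) (δ : Fin r → Fin r → ℝ)
    (hmin : ∀ s < t, ¬ ∃ c : Fin (s + 1) → Fin r, IsOneCycle H v c) :
    (Bmat H v δ).det.coeff (t + 1) = (-1) ^ t *
      ((∑ᶠ c ∈ {c : Fin (t + 1) → Fin r | IsOneCycle H v c}, cycleWeight δ c : ℝ) : ℂ) := by
  classical
  rw [← Matrix.det_transpose, Matrix.det_apply', Polynomial.finsetSum_coeff,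
    ← Fintype.sum_of_injective _ (cyclePerm_injective (t := t) H v)
      (fun c => (-1) ^ t * (cycleWeight δ c.1 : ℂ)), ← Finset.mul_sum,
    ← finsum_set_coe_eq_finsum_mem, finsum_eq_sum_of_fintype, Complex.ofReal_sum]
  · rfl
  · intro σ hσ
    simp only [Matrix.transpose_apply, ← Polynomial.C_eq_intCast, Polynomial.coeff_C_mul]
    rw [coeff_prod_Bmat_eq_zero δ hmin fun c hc h => hσ ⟨⟨c, hc⟩, h⟩, mul_zero]
  · rintro ⟨c, hc⟩
    simp only [Matrix.transpose_apply, ← Polynomial.C_eq_intCast, Polynomial.coeff_C_mul]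
    rw [prod_Bmat_cyclePerm hloop δ hc, sign_cyclePerm]
    simp

/-- Lemma (b): let `H` be a directed graph on `[r]` with no self-loops except
possibly at the vertex `1`, and let `B(x)` be the associated matrix over `ℂ[x]` built from
nonzero reals `δ_{i,j}`. Assume `∑_{C ∈ C_t^1(H)} δ_C ≠ 0` whenever `0 ≤ t < r` and
`C_t^1(H) ≠ ∅`. If `det B(x) = 0` in `ℂ[x]`, then `C_t^1(H) = ∅` for all `t ≥ 0`. -/
theorem statement8 {r : ℕ} (hr : 0 < r) (H : Set (Fin r × Fin r))
    (hloop : ∀ i : Fin r, (i, i) ∈ H → i = ⟨0, hr⟩)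
    (δ : Fin r → Fin r → ℝ) (hδ : ∀ i j, δ i j ≠ 0)
    (hsum : ∀ t : ℕ, t < r → (∃ c : Fin (t + 1) → Fin r, IsOneCycle H ⟨0, hr⟩ c) →
      (∑ᶠ c ∈ {c : Fin (t + 1) → Fin r | IsOneCycle H ⟨0, hr⟩ c}, cycleWeight δ c) ≠ 0)
    (hdet : (Bmat H ⟨0, hr⟩ δ).det = 0) :
    ∀ t : ℕ, ¬ ∃ c : Fin (t + 1) → Fin r, IsOneCycle H ⟨0, hr⟩ c := by
  classical
  intro t hex
  have hex' : ∃ t : ℕ, ∃ c : Fin (t + 1) → Fin r, IsOneCycle H ⟨0, hr⟩ c := ⟨t, hex⟩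
  obtain ⟨c, hc⟩ := Nat.find_spec hex'
  have hlt : Nat.find hex' < r := by
    simpa [Nat.succ_le_iff] using Fintype.card_le_of_injective c hc.2.1
  have hcoeff := coeff_det_Bmat hloop δ fun s hs => Nat.find_min hex' hs
  rw [hdet, Polynomial.coeff_zero] at hcoeff
  refine hsum _ hlt ⟨c, hc⟩ ?_
  simpa using hcoeff
end

section
/- Let d, g ≥ 1 and define ξ : ℝ_{++}^d × ℝ^g → ℝ^g, indexing the last g coordinates by the edges ij of a graph G on [d], by ξ(x, y) = (y_{ij}/√(x_i x_j))_{ij ∈ E}. Then the pushforward of the (d+g)-dimensional Lebesgue measure under ξ is absolutely continuous with respect to the g-dimensional Lebesgue measure; that is, for every A ⊆ ℝ^g with L^g(A) = 0, one has L^{d+g}(ξ^{-1}(A)) = 0. -/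
open MeasureTheory

/-- The map `ξ : ℝ_{++}^d × ℝ^g → ℝ^g`, `ξ(x,y)_{ij} = y_{ij} / √(x_i x_j)` where the `g`
coordinates are indexed by the edges `ij` of `G` via the enumeration `η` (the product
`x_i x_j` over the two endpoints of an edge is well-defined by symmetry). -/
noncomputable def xiMap {d g : ℕ} (G : SimpleGraph (Fin d)) (η : Fin g ≃ G.edgeSet)
    (x : Fin d → ℝ) (y : Fin g → ℝ) : Fin g → ℝ :=
  fun k => y k / Real.sqrt
    (Sym2.lift ⟨fun i j => x i * x j, fun _ _ => mul_comm _ _⟩ (η k : Sym2 (Fin d)))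

/-- Scaling each coordinate by a nonzero factor pulls Lebesgue-null sets back to null sets. -/
theorem volume_preimage_pi_mul_eq_zero {ι : Type*} [Fintype ι] {c : ι → ℝ} (hc : ∀ k, c k ≠ 0)
    {A : Set (ι → ℝ)} (hA : volume A = 0) :
    volume ((fun y : ι → ℝ => fun k => c k * y k) ⁻¹' A) = 0 := by
  classical
  have hdet : LinearMap.det (Matrix.toLin' (Matrix.diagonal c)) ≠ 0 := by
    rw [LinearMap.det_toLin', Matrix.det_diagonal]
    exact Finset.prod_ne_zero_iff.2 fun k _ => hc k
  have hmap : (fun y : ι → ℝ => fun k => c k * y k) = Matrix.toLin' (Matrix.diagonal c) := by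
    ext y k
    simp [Matrix.mulVec_diagonal]
  rw [hmap, Measure.addHaar_preimage_linearMap volume hdet, hA, mul_zero]

theorem measurable_sym2_lift_mul {ι : Type*} (e : Sym2 ι) :
    Measurable fun x : ι → ℝ =>
      Sym2.lift ⟨fun i j => x i * x j, fun _ _ => mul_comm _ _⟩ e := by
  induction e with
  | _ i j => exact (measurable_pi_apply i).mul (measurable_pi_apply j)

theorem sym2_lift_mul_pos {ι : Type*} {x : ι → ℝ} (hx : ∀ i, 0 < x i) (e : Sym2 ι) :
    0 < Sym2.lift ⟨fun i j => x i * x j, fun _ _ => mul_comm _ _⟩ e := by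
  induction e with
  | _ i j => exact mul_pos (hx i) (hx j)

theorem measurable_xiMap {d g : ℕ} (G : SimpleGraph (Fin d)) (η : Fin g ≃ G.edgeSet) :
    Measurable fun p : (Fin d → ℝ) × (Fin g → ℝ) => xiMap G η p.1 p.2 :=
  measurable_pi_lambda _ fun k =>
    ((measurable_pi_apply k).comp measurable_snd).div
      ((measurable_sym2_lift_mul (η k : Sym2 (Fin d))).comp measurable_fst).sqrt

theorem volume_preimage_xiMap_eq_zero {d g : ℕ} (G : SimpleGraph (Fin d)) (η : Fin g ≃ G.edgeSet)
    {x : Fin d → ℝ} (hx : ∀ i, 0 < x i) {A : Set (Fin g → ℝ)} (hA : volume A = 0) :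
    volume (xiMap G η x ⁻¹' A) = 0 := by
  have hc : ∀ k, (Real.sqrt (Sym2.lift ⟨fun i j => x i * x j, fun _ _ => mul_comm _ _⟩
      (η k : Sym2 (Fin d))))⁻¹ ≠ 0 := fun k =>
    inv_ne_zero (Real.sqrt_pos.2 (sym2_lift_mul_pos hx _)).ne'
  convert volume_preimage_pi_mul_eq_zero hc hA using 3
  funext y k
  exact div_eq_inv_mul _ _

/-- the pushforward of the `(d+g)`-dimensional Lebesgue measure on
`ℝ_{++}^d × ℝ^g` under `ξ` is absolutely continuous w.r.t. the `g`-dimensional Lebesgue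
measure: for every `A ⊆ ℝ^g` with `L^g(A) = 0`, `L^{d+g}(ξ⁻¹(A)) = 0`. -/
theorem statement12 {d g : ℕ} (hd : 1 ≤ d) (hg : 1 ≤ g)
    (G : SimpleGraph (Fin d)) (η : Fin g ≃ G.edgeSet)
    (A : Set (Fin g → ℝ)) (hA : volume A = 0) :
    volume {p : (Fin d → ℝ) × (Fin g → ℝ) |
      (∀ i, 0 < p.1 i) ∧ xiMap G η p.1 p.2 ∈ A} = 0 := by
  have hpos : MeasurableSet {p : (Fin d → ℝ) × (Fin g → ℝ) | ∀ i, 0 < p.1 i} := by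
    rw [Set.ofPred_forall]
    exact MeasurableSet.iInter fun i =>
      measurableSet_lt measurable_const ((measurable_pi_apply i).comp measurable_fst)
  have hmeas : MeasurableSet {p : (Fin d → ℝ) × (Fin g → ℝ) |
      (∀ i, 0 < p.1 i) ∧ xiMap G η p.1 p.2 ∈ toMeasurable volume A} :=
    hpos.inter (measurable_xiMap G η (measurableSet_toMeasurable volume A))
  refine measure_mono_null (fun p hp => And.imp_right
    (fun h => subset_toMeasurable volume A h) hp) ((Measure.measure_prod_null hmeas).2 ?_)
  refine Filter.Eventually.of_forall fun x => ?_
  by_cases hx : ∀ i, 0 < x i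
  · exact measure_mono_null (fun y hy => hy.2)
      (volume_preimage_xiMap_eq_zero G η hx ((measure_toMeasurable A).trans hA))
  · simp [hx]
end

section
/- Let G be an undirected simple graph on [d] with edge set E. Define ζ(δ,ε) := (A^{G,δ,ε})^{-1} for (δ,ε) ∈ M^G. Then ζ(M^G) = Ψ_G^{-1}, and the restriction of ζ to M_∞^G is a bijection from M_∞^G onto Ψ_G^{-1}. -/
open MeasureTheory

open Classical in
/-- The matrix `A^{G,δ,ε}`: diagonal entries `1`, entry `δ_{ij}·ε` in position `(i,j)` when
`ij` is an edge of `G`, and `0` otherwise; `η` enumerates the edges of `G`. -/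
noncomputable def AGde {d g : ℕ} (G : SimpleGraph (Fin d)) (η : Fin g ≃ G.edgeSet)
    (δ : Fin g → ℝ) (ε : ℝ) : Matrix (Fin d) (Fin d) ℝ :=
  fun i j => if i = j then 1 else
    if h : G.Adj i j then δ (η.symm ⟨s(i,j), h⟩) * ε else 0

/-- `ε_G(δ) = sup {ε > 0 : A^{G,δ,ε} is positive definite}` (a real supremum; the set is
nonempty and bounded above whenever all entries of `δ` are nonzero). -/
noncomputable def epsG {d g : ℕ} (G : SimpleGraph (Fin d)) (η : Fin g ≃ G.edgeSet)
    (δ : Fin g → ℝ) : ℝ :=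
  sSup {ε : ℝ | 0 < ε ∧ (AGde G η δ ε).PosDef}

/-- The set `M^G = {(δ,ε) : δ ∈ [-1,1]_*^E, 0 < ε < ε_G(δ)}`, viewed as a subset of
`ℝ^g × ℝ ≅ ℝ^{g+1}`. -/
def MGset {d g : ℕ} (G : SimpleGraph (Fin d)) (η : Fin g ≃ G.edgeSet) :
    Set ((Fin g → ℝ) × ℝ) :=
  {p | (∀ k, p.1 k ∈ Set.Icc (-1 : ℝ) 1 ∧ p.1 k ≠ 0) ∧ 0 < p.2 ∧ p.2 < epsG G η p.1}

/-- `Ψ_G`: the set of symmetric positive definite matrices with unit diagonal whose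
off-diagonal support is exactly the edge set of `G`. -/
def PsiG {d : ℕ} (G : SimpleGraph (Fin d)) : Set (Matrix (Fin d) (Fin d) ℝ) :=
  {Γ | Γ.PosDef ∧ (∀ i, Γ i i = 1) ∧ ∀ i j, i ≠ j → (Γ i j ≠ 0 ↔ G.Adj i j)}

/-- A real positive definite matrix stays positive definite after subtracting a small positive
multiple of the identity. -/
theorem Matrix.PosDef.exists_pos_sub_smul_one {n : Type*} [Fintype n] [DecidableEq n]
    {A : Matrix n n ℝ} (hA : A.PosDef) : ∃ c : ℝ, 0 < c ∧ (A - c • (1 : Matrix n n ℝ)).PosDef := by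
  obtain ⟨c, hc, hlt⟩ : ∃ c : ℝ, 0 < c ∧ ∀ i, c < hA.1.eigenvalues i := by
    have hev : ∀ᶠ c in nhdsWithin (0 : ℝ) (Set.Ioi 0), ∀ i, c < hA.1.eigenvalues i :=
      Filter.eventually_all.2 fun i =>
        nhdsWithin_le_nhds (eventually_lt_nhds (hA.eigenvalues_pos i))
    obtain ⟨c, h, hc⟩ := (hev.and self_mem_nhdsWithin).exists
    exact ⟨c, hc, h⟩
  refine ⟨c, hc, ?_⟩
  have key : A - c • (1 : Matrix n n ℝ) =
      Unitary.conjStarAlgAut ℝ _ hA.1.eigenvectorUnitary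
        (Matrix.diagonal fun i => hA.1.eigenvalues i - c) := by
    have hdiag : (Matrix.diagonal fun i => hA.1.eigenvalues i - c) =
        Matrix.diagonal (RCLike.ofReal ∘ hA.1.eigenvalues) - c • (1 : Matrix n n ℝ) := by
      ext i j
      by_cases hij : i = j <;> simp [hij]
    rw [hdiag, map_sub, ← hA.1.spectral_theorem, map_smul, map_one]
  rw [key, Unitary.conjStarAlgAut_apply]
  refine (Matrix.IsUnit.posDef_star_right_conjugate_iff Unitary.isUnit_coe).2 ?_
  exact Matrix.posDef_diagonal_iff.2 fun i => sub_pos.2 (hlt i)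

/-- Off-diagonal entries of a positive definite matrix with unit diagonal have absolute value
less than one. -/
theorem Matrix.PosDef.abs_apply_lt_one {n : Type*} [Fintype n] [DecidableEq n]
    {A : Matrix n n ℝ} (hA : A.PosDef) (h1 : ∀ i, A i i = 1) {i j : n} (hij : i ≠ j) :
    |A i j| < 1 := by
  have hinj : Function.Injective ![i, j] := by
    intro a b
    fin_cases a <;> fin_cases b <;> simp [hij, hij.symm]
  have hdet := (hA.submatrix hinj).det_pos
  have hsymm : A j i = A i j := by simpa using hA.1.apply i j
  simp only [Matrix.det_fin_two, Matrix.submatrix_apply, Matrix.cons_val_zero,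
    Matrix.cons_val_one, h1, hsymm] at hdet
  rw [← sq_lt_one_iff_abs_lt_one]
  linarith [sq (A i j)]

section AGde

variable {d g : ℕ} (G : SimpleGraph (Fin d)) (η : Fin g ≃ G.edgeSet)

theorem AGde_apply_self (δ : Fin g → ℝ) (ε : ℝ) (i : Fin d) : AGde G η δ ε i i = 1 := by
  simp [AGde]

theorem AGde_apply_of_adj (δ : Fin g → ℝ) (ε : ℝ) {i j : Fin d} (h : G.Adj i j) :
    AGde G η δ ε i j = δ (η.symm ⟨s(i, j), h⟩) * ε := by
  simp [AGde, h, h.ne]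

/-- Rescaling `ε` moves `A^{G,δ,ε}` along the line through the identity matrix. -/
theorem AGde_mul (δ : Fin g → ℝ) (t ε : ℝ) :
    AGde G η δ (t * ε) = t • AGde G η δ ε + (1 - t) • (1 : Matrix (Fin d) (Fin d) ℝ) := by
  ext i j
  by_cases hij : i = j
  · simp [AGde, hij]
  · by_cases h : G.Adj i j
    · simp [AGde, hij, h]; ring
    · simp [AGde, hij, h]

theorem exists_edge_index (k : Fin g) :
    ∃ (i j : Fin d) (h : G.Adj i j), η.symm ⟨s(i, j), h⟩ = k := by
  obtain ⟨⟨e, he⟩, hk⟩ : ∃ e, η k = e := ⟨_, rfl⟩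
  induction e using Sym2.ind with
  | _ i j => exact ⟨i, j, he, by rw [Equiv.symm_apply_eq, hk]⟩

theorem AGde_posDef_of_le {δ : Fin g → ℝ} {ε ε' : ℝ} (hε : 0 < ε) (hle : ε ≤ ε')
    (h : (AGde G η δ ε').PosDef) : (AGde G η δ ε).PosDef := by
  have hε' : 0 < ε' := hε.trans_le hle
  have ht : ε / ε' ≤ 1 := (div_le_one hε').2 hle
  rw [← div_mul_cancel₀ ε hε'.ne', AGde_mul]
  exact (h.smul (div_pos hε hε')).add_posSemidef
    (Matrix.PosSemidef.one.smul (sub_nonneg.2 ht))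

theorem AGde_posDef_exists_gt {δ : Fin g → ℝ} {ε : ℝ} (hε : 0 < ε)
    (h : (AGde G η δ ε).PosDef) : ∃ ε', ε < ε' ∧ (AGde G η δ ε').PosDef := by
  obtain ⟨c, hc, hP⟩ := h.exists_pos_sub_smul_one
  refine ⟨(1 + c) * ε, by nlinarith, ?_⟩
  have hsplit : AGde G η δ ((1 + c) * ε) =
      AGde G η δ ε - c • (1 : Matrix (Fin d) (Fin d) ℝ) + c • AGde G η δ ε := by
    rw [AGde_mul]
    module
  rw [hsplit]
  exact hP.add (h.smul hc)

theorem bddAbove_AGde_posDef (hg : 1 ≤ g) {δ : Fin g → ℝ} (hδ : ∀ k, δ k ≠ 0) :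
    BddAbove {ε : ℝ | 0 < ε ∧ (AGde G η δ ε).PosDef} := by
  obtain ⟨i, j, h, hk⟩ := exists_edge_index G η ⟨0, hg⟩
  refine ⟨1 / |δ ⟨0, hg⟩|, fun ε ⟨hε, hP⟩ => ?_⟩
  have hlt := hP.abs_apply_lt_one (AGde_apply_self G η δ ε) h.ne
  rw [AGde_apply_of_adj G η δ ε h, hk, abs_mul, abs_of_pos hε] at hlt
  rw [le_div_iff₀ (abs_pos.2 (hδ _)), mul_comm]
  exact hlt.le

/-- For `δ` with nonzero entries and `ε > 0`, the condition `ε < ε_G(δ)` says exactly that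
`A^{G,δ,ε}` is positive definite. -/
theorem lt_epsG_iff (hg : 1 ≤ g) {δ : Fin g → ℝ} (hδ : ∀ k, δ k ≠ 0) {ε : ℝ} (hε : 0 < ε) :
    ε < epsG G η δ ↔ (AGde G η δ ε).PosDef := by
  constructor
  · intro hlt
    have hne : {ε : ℝ | 0 < ε ∧ (AGde G η δ ε).PosDef}.Nonempty := by
      by_contra hempty
      rw [epsG, Set.not_nonempty_iff_eq_empty.1 hempty, Real.sSup_empty] at hlt
      exact lt_asymm hε hlt
    obtain ⟨ε', ⟨-, hP⟩, hε'⟩ := exists_lt_of_lt_csSup hne hlt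
    exact AGde_posDef_of_le G η hε hε'.le hP
  · intro hP
    obtain ⟨ε', hlt, hP'⟩ := AGde_posDef_exists_gt G η hε hP
    exact hlt.trans_le (le_csSup (bddAbove_AGde_posDef G η hg hδ) ⟨hε.trans hlt, hP'⟩)

theorem AGde_mem_PsiG (hg : 1 ≤ g) {p : (Fin g → ℝ) × ℝ} (hp : p ∈ MGset G η) :
    AGde G η p.1 p.2 ∈ PsiG G := by
  obtain ⟨hδ, hε, hlt⟩ := hp
  refine ⟨(lt_epsG_iff G η hg (fun k => (hδ k).2) hε).1 hlt, AGde_apply_self G η _ _, ?_⟩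
  intro i j hij
  by_cases h : G.Adj i j
  · rw [AGde_apply_of_adj G η _ _ h]
    exact iff_of_true (mul_ne_zero (hδ _).2 hε.ne') h
  · simp [AGde, hij, h]

theorem exists_AGde_eq (hg : 1 ≤ g) {Γ : Matrix (Fin d) (Fin d) ℝ} (hΓ : Γ ∈ PsiG G) :
    ∃ p ∈ MGset G η ∩ {p | ‖p.1‖ = 1}, AGde G η p.1 p.2 = Γ := by
  obtain ⟨hP, h1, hsupp⟩ := hΓ
  choose a b hab hk using exists_edge_index G η
  set v : Fin g → ℝ := fun k => Γ (a k) (b k) with hv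
  have hv0 : ∀ k, v k ≠ 0 := fun k => (hsupp _ _ (hab k).ne).2 (hab k)
  have hvadj : ∀ i j (h : G.Adj i j), v (η.symm ⟨s(i, j), h⟩) = Γ i j := by
    intro i j h
    have hs := congrArg Subtype.val (η.symm.injective (hk (η.symm ⟨s(i, j), h⟩)))
    rcases Sym2.eq_iff.1 hs with ⟨h₁, h₂⟩ | ⟨h₁, h₂⟩
    · simp only [hv, h₁, h₂]
    · simp only [hv, h₁, h₂]
      simpa using hP.1.apply i j
  have hnorm : 0 < ‖v‖ := norm_pos_iff.2 fun h0 => hv0 ⟨0, hg⟩ (congrFun h0 _)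
  have hunit : ‖‖v‖⁻¹ • v‖ = 1 := by
    rw [norm_smul, norm_inv, norm_norm, inv_mul_cancel₀ hnorm.ne']
  have hA : AGde G η (‖v‖⁻¹ • v) ‖v‖ = Γ := by
    ext i j
    by_cases hij : i = j
    · rw [hij, AGde_apply_self, h1]
    · by_cases h : G.Adj i j
      · rw [AGde_apply_of_adj G η _ _ h, Pi.smul_apply, smul_eq_mul, hvadj]
        field_simp
      · have h0 : Γ i j = 0 := by
          by_contra hne
          exact h ((hsupp i j hij).1 hne)
        simp [AGde, hij, h, h0]
  have hδ0 : ∀ k, (‖v‖⁻¹ • v) k ≠ 0 := fun k => mul_ne_zero (inv_ne_zero hnorm.ne') (hv0 k)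
  refine ⟨(‖v‖⁻¹ • v, ‖v‖), ⟨⟨fun k => ⟨?_, hδ0 k⟩, hnorm, ?_⟩, hunit⟩, hA⟩
  · exact abs_le.1 ((norm_le_pi_norm (‖v‖⁻¹ • v) k).trans_eq hunit)
  · exact (lt_epsG_iff G η hg hδ0 hnorm).2 (hA.symm ▸ hP)

theorem AGde_injOn :
    Set.InjOn (fun p : (Fin g → ℝ) × ℝ => AGde G η p.1 p.2)
      (MGset G η ∩ {p | ‖p.1‖ = 1}) := by
  rintro ⟨δ, ε⟩ ⟨⟨-, hε, -⟩, hn⟩ ⟨δ', ε'⟩ ⟨⟨-, hε', -⟩, hn'⟩ heq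
  simp only [Set.mem_ofPred_eq] at hε hε' hn hn' heq
  have hsmul : ε • δ = ε' • δ' := by
    ext k
    obtain ⟨i, j, h, hk⟩ := exists_edge_index G η k
    have hij := congrFun (congrFun heq i) j
    rw [AGde_apply_of_adj G η _ _ h, AGde_apply_of_adj G η _ _ h, hk] at hij
    simpa [mul_comm] using hij
  have hεε' : ε = ε' := by
    simpa [norm_smul, hn, hn', abs_of_pos hε, abs_of_pos hε'] using congrArg norm hsmul
  subst hεε'
  rw [smul_right_injective _ hε.ne' hsmul]

end AGde

theorem injOn_inv_PsiG {d : ℕ} (G : SimpleGraph (Fin d)) :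
    Set.InjOn (Inv.inv : Matrix (Fin d) (Fin d) ℝ → _) (PsiG G) := by
  intro Γ hΓ Γ' hΓ' h
  have hdet : ∀ {Δ}, Δ ∈ PsiG G → IsUnit Δ.det := fun hΔ => hΔ.1.det_pos.ne'.isUnit
  rw [← Matrix.nonsing_inv_nonsing_inv Γ (hdet hΓ), h,
    Matrix.nonsing_inv_nonsing_inv Γ' (hdet hΓ')]

/-- for a simple graph `G` on `[d]` with `g ≥ 1` edges (enumerated by `η`),
the map `ζ(δ,ε) = (A^{G,δ,ε})⁻¹` maps `M^G` onto `Ψ_G⁻¹ = {Γ⁻¹ : Γ ∈ Ψ_G}`, and its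
restriction to `M_∞^G = M^G ∩ (S^E_∞ × ℝ)` is a bijection from `M_∞^G` onto `Ψ_G⁻¹`. -/
theorem statement15 {d g : ℕ} (G : SimpleGraph (Fin d)) (η : Fin g ≃ G.edgeSet)
    (hg : 1 ≤ g) :
    (fun p : (Fin g → ℝ) × ℝ => (AGde G η p.1 p.2)⁻¹) '' MGset G η = Inv.inv '' PsiG G ∧
    Set.BijOn (fun p : (Fin g → ℝ) × ℝ => (AGde G η p.1 p.2)⁻¹)
      (MGset G η ∩ {p | ‖p.1‖ = 1}) (Inv.inv '' PsiG G) := by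
  have hbij : Set.BijOn (fun p : (Fin g → ℝ) × ℝ => AGde G η p.1 p.2)
      (MGset G η ∩ {p | ‖p.1‖ = 1}) (PsiG G) :=
    ⟨fun _ hp => AGde_mem_PsiG G η hg hp.1, AGde_injOn G η, fun _ hΓ => exists_AGde_eq G η hg hΓ⟩
  refine ⟨Set.Subset.antisymm ?_ ?_, (injOn_inv_PsiG G).bijOn_image.comp hbij⟩
  · rintro _ ⟨p, hp, rfl⟩
    exact ⟨_, AGde_mem_PsiG G η hg hp, rfl⟩
  · rintro _ ⟨Γ, hΓ, rfl⟩
    obtain ⟨p, hp, hpΓ⟩ := exists_AGde_eq G η hg hΓ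
    exact ⟨p, hp.1, congrArg Inv.inv hpΓ⟩
end

section
/- Let G be an undirected simple graph on [d] with g = |E| ≥ 1 edges. The function ε_G restricted to S^E_{∞,*} := {δ ∈ ℝ^E : ‖δ‖_∞ = 1, δ_ij ≠ 0 for all ij ∈ E} is continuous and bounded, and the set M_∞^G ⊆ ℝ^{g+1} has finite and strictly positive g-dimensional Hausdorff measure. -/
open MeasureTheory

/-- The set `M_∞^G = {(δ,ε) : δ ∈ [-1,1]_*^E, ‖δ‖_∞ = 1, 0 < ε < ε_G(δ)}`, viewed as a
subset of `ℝ^g × ℝ ≅ ℝ^{g+1}`. -/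
def MGinf {d g : ℕ} (G : SimpleGraph (Fin d)) (η : Fin g ≃ G.edgeSet) :
    Set ((Fin g → ℝ) × ℝ) :=
  {p | (∀ k, p.1 k ∈ Set.Icc (-1 : ℝ) 1 ∧ p.1 k ≠ 0) ∧ ‖p.1‖ = 1 ∧
    0 < p.2 ∧ p.2 < epsG G η p.1}

open Classical in
/-- The quadratic form of the off-diagonal part of `AGde G η δ 1`. -/
noncomputable def edgeForm {d g : ℕ} (G : SimpleGraph (Fin d)) (η : Fin g ≃ G.edgeSet)
    (δ : Fin g → ℝ) (x : Fin d → ℝ) : ℝ :=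
  ∑ i, ∑ j, if h : G.Adj i j then x i * δ (η.symm ⟨s(i,j), h⟩) * x j else 0

section

variable {d g : ℕ} (G : SimpleGraph (Fin d)) (η : Fin g ≃ G.edgeSet)

lemma isHermitian_AGde (δ : Fin g → ℝ) (ε : ℝ) : (AGde G η δ ε).IsHermitian := by
  ext i j
  simp only [Matrix.conjTranspose_apply, AGde, star_trivial]
  by_cases hij : i = j
  · simp [hij]
  · by_cases h : G.Adj i j
    · have e : (⟨s(j, i), h.symm⟩ : G.edgeSet) = ⟨s(i, j), h⟩ := Subtype.ext Sym2.eq_swap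
      simp [hij, Ne.symm hij, h, h.symm, e]
    · have h' : ¬ G.Adj j i := fun h' => h h'.symm
      simp [hij, Ne.symm hij, h, h']

lemma posDef_AGde_iff (δ : Fin g → ℝ) (ε : ℝ) :
    (AGde G η δ ε).PosDef ↔ ∀ x : Fin d → ℝ, x ≠ 0 → 0 < ∑ i, x i ^ 2 + ε * edgeForm G η δ x := by
  rw [Matrix.posDef_iff_dotProduct_mulVec, and_iff_right (isHermitian_AGde G η δ ε)]
  have key : ∀ x : Fin d → ℝ, star x ⬝ᵥ (AGde G η δ ε).mulVec x
      = ∑ i, x i ^ 2 + ε * edgeForm G η δ x := by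
    intro x
    simp only [dotProduct, Matrix.mulVec, edgeForm, Finset.mul_sum, ← Finset.sum_add_distrib,
      star_trivial]
    refine Finset.sum_congr rfl fun i _ => ?_
    have hx : x i ^ 2 = ∑ j, if i = j then x i * x j else 0 := by simp [sq]
    rw [hx, ← Finset.sum_add_distrib]
    refine Finset.sum_congr rfl fun j _ => ?_
    by_cases hij : i = j
    · subst hij; simp [AGde]
    · by_cases h : G.Adj i j
      · simp only [AGde, hij, h, if_false, dif_pos]; ring
      · simp [AGde, hij, h]
  simp only [key]

lemma edgeForm_sub (δ δ' : Fin g → ℝ) (x : Fin d → ℝ) :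
    edgeForm G η (δ - δ') x = edgeForm G η δ x - edgeForm G η δ' x := by
  simp only [edgeForm, ← Finset.sum_sub_distrib]
  refine Finset.sum_congr rfl fun i _ => Finset.sum_congr rfl fun j _ => ?_
  split_ifs
  · simp only [Pi.sub_apply]; ring
  · simp

lemma abs_edgeForm_le (δ : Fin g → ℝ) (x : Fin d → ℝ) :
    |edgeForm G η δ x| ≤ ‖δ‖ * (d * ∑ i, x i ^ 2) := by
  have h1 : |edgeForm G η δ x| ≤ ∑ i, ∑ j, ‖δ‖ * (|x i| * |x j|) := by
    refine (Finset.abs_sum_le_sum_abs _ _).trans (Finset.sum_le_sum fun i _ => ?_)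
    refine (Finset.abs_sum_le_sum_abs _ _).trans (Finset.sum_le_sum fun j _ => ?_)
    split_ifs with h
    · have := norm_le_pi_norm δ (η.symm ⟨s(i,j), h⟩)
      rw [Real.norm_eq_abs] at this
      rw [abs_mul, abs_mul]
      nlinarith [mul_nonneg (abs_nonneg (x i)) (abs_nonneg (x j))]
    · rw [abs_zero]; positivity
  have h2 : ∑ i, ∑ j, ‖δ‖ * (|x i| * |x j|) = ‖δ‖ * (∑ i, |x i|) ^ 2 := by
    rw [sq, Finset.sum_mul_sum]
    simp only [Finset.mul_sum]
  have h3 : (∑ i, |x i|) ^ 2 ≤ d * ∑ i, x i ^ 2 := by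
    simpa using sq_sum_le_card_mul_sum_sq (s := Finset.univ) (f := fun i => |x i|)
  rw [h2] at h1
  exact h1.trans (mul_le_mul_of_nonneg_left h3 (norm_nonneg _))

lemma continuous_edgeForm (x : Fin d → ℝ) : Continuous fun δ => edgeForm G η δ x := by
  unfold edgeForm
  refine continuous_finsetSum _ fun i _ => continuous_finsetSum _ fun j _ => ?_
  split_ifs
  · fun_prop
  · fun_prop

lemma sum_sq_pos_of_ne_zero {x : Fin d → ℝ} (hx : x ≠ 0) : 0 < ∑ i, x i ^ 2 := by
  obtain ⟨i, hi⟩ := Function.ne_iff.1 hx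
  exact Finset.sum_pos' (fun i _ => sq_nonneg _) ⟨i, Finset.mem_univ _, sq_pos_of_ne_zero hi⟩

lemma lt_one_of_posDef_AGde {δ : Fin g → ℝ} (hδ : ‖δ‖ = 1) {ε : ℝ} (hε : 0 < ε)
    (h : (AGde G η δ ε).PosDef) : ε < 1 := by
  obtain ⟨k, hk⟩ : ∃ k, 1 ≤ |δ k| := by
    by_contra! hc
    have := (pi_norm_lt_iff (x := δ) one_pos).2 hc
    linarith
  obtain ⟨e, he⟩ : ∃ e, η k = e := ⟨_, rfl⟩
  obtain ⟨e, hmem⟩ := e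
  induction e with
  | _ i j =>
    have hadj : G.Adj i j := hmem
    have hij : i ≠ j := hadj.ne
    have hinj : Function.Injective ![i, j] := by
      intro a b hab
      fin_cases a <;> fin_cases b <;> simp_all
    have hdet := (h.submatrix hinj).det_pos
    have h1 : AGde G η δ ε i j = δ k * ε := by
      have : η.symm ⟨s(i, j), hadj⟩ = k := by rw [Equiv.symm_apply_eq, he]
      simp [AGde, hij, hadj, this]
    have h2 : AGde G η δ ε j i = δ k * ε := by
      rw [← h1]; simpa using (isHermitian_AGde G η δ ε).apply i j
    have h3 : ∀ i, AGde G η δ ε i i = 1 := fun i => by simp [AGde]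
    rw [Matrix.det_fin_two] at hdet
    simp only [Matrix.submatrix_apply, Matrix.cons_val_zero, Matrix.cons_val_one, h1, h2, h3]
      at hdet
    have hsq : 1 ≤ δ k ^ 2 := by rw [← sq_abs]; nlinarith
    nlinarith [mul_le_mul_of_nonneg_right hsq (sq_nonneg ε)]

lemma bddAbove_posDef_AGde {δ : Fin g → ℝ} (hδ : ‖δ‖ = 1) :
    BddAbove {ε : ℝ | 0 < ε ∧ (AGde G η δ ε).PosDef} :=
  ⟨1, fun _ h => (lt_one_of_posDef_AGde G η hδ h.1 h.2).le⟩

lemma epsG_le_one {δ : Fin g → ℝ} (hδ : ‖δ‖ = 1) : epsG G η δ ≤ 1 :=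
  Real.sSup_le (fun _ h => (lt_one_of_posDef_AGde G η hδ h.1 h.2).le) zero_le_one

lemma le_epsG {δ : Fin g → ℝ} (hδ : ‖δ‖ = 1) {ε : ℝ} (hε : 0 < ε)
    (h : (AGde G η δ ε).PosDef) : ε ≤ epsG G η δ :=
  le_csSup (bddAbove_posDef_AGde G η hδ) ⟨hε, h⟩

lemma inv_le_epsG {δ : Fin g → ℝ} (hδ : ‖δ‖ = 1) : ((d : ℝ) + 1)⁻¹ ≤ epsG G η δ := by
  refine le_epsG G η hδ (by positivity) ((posDef_AGde_iff G η _ _).2 fun x hx => ?_)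
  have hq := sum_sq_pos_of_ne_zero hx
  have hB := (abs_le.1 (abs_edgeForm_le G η δ x)).1
  rw [hδ, one_mul] at hB
  have hd : (0 : ℝ) < d + 1 := by positivity
  have : 0 < ((d : ℝ) + 1)⁻¹ * ((d + 1) * ∑ i, x i ^ 2 + edgeForm G η δ x) :=
    mul_pos (by positivity) (by linarith)
  rwa [mul_add, inv_mul_cancel_left₀ hd.ne'] at this

lemma epsG_pos {δ : Fin g → ℝ} (hδ : ‖δ‖ = 1) : 0 < epsG G η δ :=
  lt_of_lt_of_le (by positivity) (inv_le_epsG G η hδ)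

lemma posDef_AGde_of_lt_epsG {δ : Fin g → ℝ} {a : ℝ} (ha : 0 < a)
    (h : a < epsG G η δ) : (AGde G η δ a).PosDef := by
  have hne : {ε : ℝ | 0 < ε ∧ (AGde G η δ ε).PosDef}.Nonempty := by
    by_contra hc
    rw [Set.not_nonempty_iff_eq_empty] at hc
    rw [epsG, hc, Real.sSup_empty] at h
    linarith
  obtain ⟨c, ⟨hc, hpd⟩, hac⟩ := exists_lt_of_lt_csSup hne h
  rw [posDef_AGde_iff] at hpd ⊢
  intro x hx
  have hq := sum_sq_pos_of_ne_zero hx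
  have hp := hpd x hx
  by_contra! hn
  nlinarith

lemma continuousOn_epsG : ContinuousOn (epsG G η) {δ : Fin g → ℝ | ‖δ‖ = 1} := by
  intro δ₀ (hδ₀ : ‖δ₀‖ = 1)
  have hpos := epsG_pos G η hδ₀
  refine tendsto_order.2 ⟨fun a ha => ?_, fun b hb => ?_⟩
  · obtain ⟨b, hab, hb⟩ := exists_between (max_lt ha hpos)
    obtain ⟨c, hbc, hc⟩ := exists_between hb
    have hb0 : 0 < b := (le_max_right _ _).trans_lt hab
    have hc0 : 0 < c := hb0.trans hbc
    have hpd := (posDef_AGde_iff G η _ _).1 (posDef_AGde_of_lt_epsG G η hc0 hc)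
    have hcont : Continuous fun δ : Fin g → ℝ => c * (b * (‖δ - δ₀‖ * d)) := by fun_prop
    have hev := hcont.continuousAt.eventually_lt (x₀ := δ₀)
      (continuousAt_const (y := c - b)) (by simpa using hbc)
    filter_upwards [self_mem_nhdsWithin, nhdsWithin_le_nhds hev] with δ hδ hlt
    refine ((le_max_left _ _).trans_lt hab).trans_le
      (le_epsG G η hδ hb0 ((posDef_AGde_iff G η _ _).2 fun x hx => ?_))
    have hq := sum_sq_pos_of_ne_zero hx
    have hp := hpd x hx
    have hB := (abs_le.1 (abs_edgeForm_le G η (δ - δ₀) x)).1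
    rw [edgeForm_sub] at hB
    have h1 := mul_lt_mul_of_pos_right hlt hq
    have h2 := mul_le_mul_of_nonneg_left hB (mul_pos hc0 hb0).le
    have h3 := mul_pos hb0 hp
    refine pos_of_mul_pos_right (a := c) ?_ hc0.le
    linarith
  · obtain ⟨c, hc, hcb⟩ := exists_between hb
    obtain ⟨b', hcb', hbb⟩ := exists_between hcb
    have hc0 := hpos.trans hc
    have hn : ¬ (AGde G η δ₀ c).PosDef := fun h => (le_epsG G η hδ₀ hc0 h).not_gt hc
    rw [posDef_AGde_iff] at hn
    push Not at hn
    obtain ⟨x, hx, hle⟩ := hn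
    have hq := sum_sq_pos_of_ne_zero hx
    have hneg : ∑ i, x i ^ 2 + b' * edgeForm G η δ₀ x < 0 := by
      have : edgeForm G η δ₀ x < 0 := by
        by_contra! h
        nlinarith [mul_nonneg hc0.le h]
      nlinarith
    have hcont : Continuous fun δ => ∑ i, x i ^ 2 + b' * edgeForm G η δ x :=
      continuous_const.add (continuous_const.mul (continuous_edgeForm G η x))
    have hev := hcont.continuousAt.eventually_lt (continuousAt_const (y := (0 : ℝ))) hneg
    filter_upwards [nhdsWithin_le_nhds hev] with δ hlt
    refine lt_of_le_of_lt ?_ hbb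
    by_contra! h
    exact ((posDef_AGde_iff G η _ _).1
      (posDef_AGde_of_lt_epsG G η (hc0.trans hcb') h) x hx).not_gt hlt

end

/-- The coordinates of `y`, with the `k`-th one moved to the last factor and replaced by `s`. -/
def faceMap {g : ℕ} (k : Fin g) (s : ℝ) (y : Fin g → ℝ) : (Fin g → ℝ) × ℝ :=
  (Function.update y k s, y k)

lemma isometry_faceMap {g : ℕ} (k : Fin g) (s : ℝ) : Isometry (faceMap k s) := by
  refine Isometry.of_dist_eq fun y z => ?_
  simp only [faceMap, Prod.dist_eq]
  apply le_antisymm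
  · refine max_le ((dist_pi_le_iff dist_nonneg).2 fun i => ?_) (dist_le_pi_dist y z k)
    by_cases hi : i = k
    · subst hi; simp
    · simpa [hi] using dist_le_pi_dist y z i
  · refine (dist_pi_le_iff (le_max_of_le_right dist_nonneg)).2 fun i => ?_
    by_cases hi : i = k
    · subst hi; exact le_max_right _ _
    · refine le_max_of_le_left ?_
      simpa [hi] using dist_le_pi_dist (Function.update y k s) (Function.update z k s) i

lemma hausdorffMeasure_image_faceMap {g : ℕ} (k : Fin g) (s : ℝ) (t : Set (Fin g → ℝ)) :
    μH[(g : ℝ)] (faceMap k s '' t) = volume t := by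
  rw [(isometry_faceMap k s).hausdorffMeasure_image (Or.inl (by positivity)),
    ← hausdorffMeasure_pi_real, Fintype.card_fin]

lemma MGinf_subset {d g : ℕ} (G : SimpleGraph (Fin d)) (η : Fin g ≃ G.edgeSet) :
    MGinf G η ⊆ ⋃ k : Fin g, (faceMap k 1 '' Set.Icc (-1) 1 ∪ faceMap k (-1) '' Set.Icc (-1) 1) := by
  rintro ⟨δ, ε⟩ ⟨hk, hδ, hε, hlt⟩
  dsimp only at hk hδ hε hlt
  have hε1 : ε < 1 := hlt.trans_le (epsG_le_one G η hδ)
  obtain ⟨k, hk1⟩ : ∃ k, 1 ≤ |δ k| := by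
    by_contra! hc
    have := (pi_norm_lt_iff (x := δ) one_pos).2 hc
    linarith
  have hmem : Function.update δ k ε ∈ Set.Icc (-1 : Fin g → ℝ) 1 := by
    refine ⟨fun i => ?_, fun i => ?_⟩ <;> by_cases hi : i = k
    · subst hi; simp; linarith
    · simpa [hi] using (hk i).1.1
    · subst hi; simp; linarith
    · simpa [hi] using (hk i).1.2
  have hface : faceMap k (δ k) (Function.update δ k ε) = (δ, ε) := by simp [faceMap]
  refine Set.mem_iUnion.2 ⟨k, ?_⟩
  rcases le_abs.1 hk1 with h | h
  · rw [le_antisymm (hk k).1.2 h] at hface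
    exact Or.inl ⟨_, hmem, hface⟩
  · have : δ k = -1 := by linarith [(hk k).1.1]
    rw [this] at hface
    exact Or.inr ⟨_, hmem, hface⟩

lemma image_faceMap_subset_MGinf {d g : ℕ} (G : SimpleGraph (Fin d)) (η : Fin g ≃ G.edgeSet)
    (k : Fin g) :
    faceMap k 1 '' Set.pi Set.univ (fun _ => Set.Ioo (0 : ℝ) ((d : ℝ) + 1)⁻¹) ⊆ MGinf G η := by
  rintro _ ⟨y, hy, rfl⟩
  have hy : ∀ i, 0 < y i ∧ y i < ((d : ℝ) + 1)⁻¹ := fun i => hy i (Set.mem_univ i)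
  have hd : ((d : ℝ) + 1)⁻¹ ≤ 1 := inv_le_one_of_one_le₀ (by simp)
  have hu : ∀ i, 0 < Function.update y k 1 i ∧ Function.update y k 1 i ≤ 1 := by
    intro i
    by_cases hi : i = k
    · subst hi; simp
    · simpa [hi] using ⟨(hy i).1, (hy i).2.le.trans hd⟩
  have hnorm : ‖Function.update y k 1‖ = 1 := by
    apply le_antisymm
    · refine (pi_norm_le_iff_of_nonneg zero_le_one).2 fun i => ?_
      rw [Real.norm_eq_abs, abs_of_pos (hu i).1]
      exact (hu i).2
    · simpa using norm_le_pi_norm (Function.update y k 1) k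
  exact ⟨fun i => ⟨⟨(neg_one_lt_zero.trans (hu i).1).le, (hu i).2⟩, (hu i).1.ne'⟩, hnorm, (hy k).1,
    (hy k).2.trans_le (inv_le_epsG G η hnorm)⟩

/-- for a simple graph `G` on `[d]` with `g ≥ 1` edges (enumerated by `η`),
the function `ε_G` restricted to `S^E_{∞,*}` is continuous and bounded, and `M_∞^G` has
finite and strictly positive `g`-dimensional Hausdorff measure. -/
theorem statement17 {d g : ℕ} (G : SimpleGraph (Fin d)) (η : Fin g ≃ G.edgeSet)
    (hg : 1 ≤ g) :
    ContinuousOn (epsG G η) {δ : Fin g → ℝ | ‖δ‖ = 1 ∧ ∀ k, δ k ≠ 0} ∧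
    (∃ C : ℝ, ∀ δ : Fin g → ℝ, ‖δ‖ = 1 → (∀ k, δ k ≠ 0) → |epsG G η δ| ≤ C) ∧
    0 < μH[(g : ℝ)] (MGinf G η) ∧ μH[(g : ℝ)] (MGinf G η) < ⊤ := by
  refine ⟨(continuousOn_epsG G η).mono fun δ h => h.1, ⟨1, fun δ hδ _ => ?_⟩, ?_, ?_⟩
  · rw [abs_of_pos (epsG_pos G η hδ)]
    exact epsG_le_one G η hδ
  · refine lt_of_lt_of_le ?_ (measure_mono (image_faceMap_subset_MGinf G η ⟨0, hg⟩))
    rw [hausdorffMeasure_image_faceMap]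
    refine (isOpen_set_pi Set.finite_univ fun _ _ => isOpen_Ioo).measure_pos _ ?_
    exact Set.univ_pi_nonempty_iff.2 fun _ => Set.nonempty_Ioo.2 (by positivity)
  · refine (measure_mono (MGinf_subset G η)).trans_lt ?_
    refine (measure_iUnion_le _).trans_lt ?_
    rw [tsum_fintype]
    refine ENNReal.sum_lt_top.2 fun k _ => ?_
    refine (measure_union_le _ _).trans_lt ?_
    rw [hausdorffMeasure_image_faceMap, hausdorffMeasure_image_faceMap]
    exact ENNReal.add_lt_top.2 ⟨isCompact_Icc.measure_lt_top, isCompact_Icc.measure_lt_top⟩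
end
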